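/- arXiv:0711.5004 — 2 statements merged into one kernel-verified Lean document; each statement's English description precedes it below -/
import Mathlib

section
/- There is an absolute constant c > 0 such that for all sufficiently large l, the 3-colour 3-uniform hypergraph Ramsey number satisfies r_3(l,l,l) ≥ 2^(l^(c·log log l)). Equivalently, for every natural number N < 2^(l^(c·log log l)) there exists a colouring of the 3-element subsets of {1,…,N} with 3 colours such that no set of l vertices has all of its 3-element subsets the same colour. -/
open Filter


/-- Number of functions constrained to lie in `A` on `T`. -/
lemma count_aux {E F : Type} [Fintype E] [DecidableEq E] [Fintype F] [DecidableEq F]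
    (T : Finset E) (A : Finset F) (hF : 0 < Fintype.card F) :
    ((Finset.univ.filter (fun f : E → F => ∀ e ∈ T, f e ∈ A)).card : ℝ)
      = ((A.card : ℝ) / Fintype.card F) ^ T.card * (Fintype.card F : ℝ) ^ (Fintype.card E) := by
  have h1 : Finset.univ.filter (fun f : E → F => ∀ e ∈ T, f e ∈ A)
      = Fintype.piFinset (fun e => if e ∈ T then A else Finset.univ) := by
    ext f
    simp only [Finset.mem_filter, Finset.mem_univ, true_and, Fintype.mem_piFinset]
    refine forall_congr' fun e => ?_
    split_ifs with h <;> simp [h]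
  have hF' : (0 : ℝ) < Fintype.card F := by exact_mod_cast hF
  rw [h1, Fintype.card_piFinset]
  have h2 : ∀ e, (if e ∈ T then A else Finset.univ).card
      = if e ∈ T then A.card else Fintype.card F := by
    intro e; split_ifs <;> simp
  simp only [h2]
  rw [Finset.prod_ite]
  simp only [Finset.prod_const]
  have h3 : (Finset.univ.filter (fun e => e ∈ T)) = T := by ext; simp
  have h4 : Fintype.card E = T.card + (Finset.univ.filter (fun e => e ∉ T)).card := by
    conv_lhs => rw [← Finset.card_univ,
      ← Finset.card_filter_add_card_filter_not (s := Finset.univ) (fun e => e ∈ T), h3]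
  rw [h3, h4, pow_add, div_pow]
  push_cast
  field_simp

lemma exists_graph_fin (n s t m : ℕ) (hm : 2 ≤ m)
    (hs : (n : ℝ) ^ s * (1 / (m : ℝ)) ^ (s.choose 2) ≤ 1 / 2)
    (ht : (n : ℝ) ^ t * (1 - 1 / (m : ℝ)) ^ (t.choose 2) < 1 / 2) :
    ∃ f : Sym2 (Fin n) → Prop,
      (∀ K : Finset (Fin n), K.card = s → ∃ i ∈ K, ∃ j ∈ K, i ≠ j ∧ ¬ f s(i, j)) ∧
      (∀ K : Finset (Fin n), K.card = t → ∃ i ∈ K, ∃ j ∈ K, i ≠ j ∧ f s(i, j)) := by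
  classical
  have : NeZero m := ⟨by omega⟩
  let P : Finset (Fin n) → Finset (Sym2 (Fin n)) := fun K => K.offDiag.image (fun p => s(p.1, p.2))
  have hP : ∀ K, (P K).card = K.card.choose 2 := fun K => Sym2.card_image_offDiag K
  let A : Finset (Fin m) := {0}
  let bad : Finset (Fin m) → Finset (Fin n) → Finset (Sym2 (Fin n) → Fin m) := fun A K =>
    Finset.univ.filter (fun f => ∀ e ∈ P K, f e ∈ A)
  let tot : ℝ := (m : ℝ) ^ (Fintype.card (Sym2 (Fin n)))
  have hm0 : (0 : ℝ) < m := by exact_mod_cast (by omega : 0 < m)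
  have htot : 0 < tot := by positivity
  have hbad : ∀ A K, ((bad A K).card : ℝ) = ((A.card : ℝ) / m) ^ (K.card.choose 2) * tot := by
    intro A K
    have := count_aux (P K) A (by simp; omega)
    simpa [hP, tot] using this
  have hunion : ∀ (A : Finset (Fin m)) (k : ℕ),
      ((((Finset.univ : Finset (Fin n)).powersetCard k).biUnion (bad A)).card : ℝ)
        ≤ (n : ℝ) ^ k * ((A.card : ℝ) / m) ^ (k.choose 2) * tot := by
    intro A k
    calc ((((Finset.univ : Finset (Fin n)).powersetCard k).biUnion (bad A)).card : ℝ)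
        ≤ ∑ K ∈ (Finset.univ : Finset (Fin n)).powersetCard k, ((bad A K).card : ℝ) := by
          exact_mod_cast Finset.card_biUnion_le
      _ = ∑ K ∈ (Finset.univ : Finset (Fin n)).powersetCard k,
            ((A.card : ℝ) / m) ^ (k.choose 2) * tot := by
          refine Finset.sum_congr rfl fun K hK => ?_
          rw [hbad, (Finset.mem_powersetCard.1 hK).2]
      _ = (n.choose k : ℝ) * (((A.card : ℝ) / m) ^ (k.choose 2) * tot) := by
          simp
      _ ≤ (n : ℝ) ^ k * (((A.card : ℝ) / m) ^ (k.choose 2) * tot) := by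
          gcongr
          exact_mod_cast Nat.choose_le_pow n k
      _ = _ := by ring
  let B1 := ((Finset.univ : Finset (Fin n)).powersetCard s).biUnion (bad {0})
  let B2 := ((Finset.univ : Finset (Fin n)).powersetCard t).biUnion (bad {0}ᶜ)
  have h1 : (B1.card : ℝ) ≤ 1 / 2 * tot := by
    refine (hunion {0} s).trans ?_
    gcongr
    simpa using hs
  have h2 : (B2.card : ℝ) < 1 / 2 * tot := by
    refine (hunion {0}ᶜ t).trans_lt ?_
    have e : ((({0}ᶜ : Finset (Fin m)).card : ℝ) / m) = 1 - 1 / (m : ℝ) := by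
      rw [Finset.card_compl, Finset.card_singleton, Fintype.card_fin, Nat.cast_sub (by omega)]
      field_simp
      simp
    rw [e]
    exact mul_lt_mul_of_pos_right ht htot
  have h3 : ((B1 ∪ B2).card : ℝ) < ((Finset.univ : Finset (Sym2 (Fin n) → Fin m)).card : ℝ) := by
    have : ((B1 ∪ B2).card : ℝ) ≤ B1.card + B2.card := by exact_mod_cast Finset.card_union_le _ _
    have h4 : ((Finset.univ : Finset (Sym2 (Fin n) → Fin m)).card : ℝ) = tot := by
      simp [tot]
    rw [h4]; linarith
  have h3' : (B1 ∪ B2).card < (Finset.univ : Finset (Sym2 (Fin n) → Fin m)).card := by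
    exact_mod_cast h3
  obtain ⟨f, -, hf⟩ := Finset.exists_mem_notMem_of_card_lt_card h3'
  simp only [Finset.mem_union, not_or, B1, B2, Finset.mem_biUnion, not_exists, not_and,
    Finset.mem_powersetCard, bad, Finset.mem_filter, Finset.mem_univ, true_and, P,
    Finset.mem_image, Finset.mem_offDiag, Finset.subset_univ] at hf
  refine ⟨fun e => f e = 0, ?_, ?_⟩
  · intro K hK
    have := hf.1 K hK
    push Not at this
    obtain ⟨e, ⟨⟨i, j⟩, ⟨hi, hj, hij⟩, rfl⟩, he⟩ := this
    exact ⟨i, hi, j, hj, hij, by simpa using he⟩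
  · intro K hK
    have := hf.2 K hK
    push Not at this
    obtain ⟨e, ⟨⟨i, j⟩, ⟨hi, hj, hij⟩, rfl⟩, he⟩ := this
    exact ⟨i, hi, j, hj, hij, by simpa using he⟩

lemma exists_graph (n s t : ℕ) (hs : 1 ≤ s) (hc : 1 ≤ s.choose 2)
    (hn : n ≤ 2 ^ (s.choose 2 - 1)) (ht : 2 ^ (4 * s) ≤ t) :
    ∃ B : ℕ → ℕ → Prop, (∀ i j, B i j → B j i) ∧
      (∀ K : Finset ℕ, (∀ i ∈ K, i < n) → K.card = s → ∃ i ∈ K, ∃ j ∈ K, i ≠ j ∧ ¬ B i j) ∧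
      (∀ K : Finset ℕ, (∀ i ∈ K, i < n) → K.card = t → ∃ i ∈ K, ∃ j ∈ K, i ≠ j ∧ B i j) := by
  obtain ⟨f, hf1, hf2⟩ := exists_graph_fin n s t (2 ^ s)
    (by calc 2 = 2 ^ 1 := rfl
          _ ≤ 2 ^ s := Nat.pow_le_pow_right (by norm_num) hs)
    (by
      have h1 : (n : ℝ) ≤ 2 ^ (s.choose 2 - 1) := by exact_mod_cast hn
      have h2 : (n : ℝ) ^ s ≤ (2 ^ (s.choose 2 - 1)) ^ s := by gcongr
      have h3 : (2 : ℝ) * (2 ^ (s.choose 2 - 1)) ^ s ≤ (2 ^ s) ^ (s.choose 2) := by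
        obtain ⟨d, hd⟩ := Nat.exists_eq_add_of_le hc
        rw [hd]
        calc (2 : ℝ) * (2 ^ (1 + d - 1)) ^ s = 2 ^ (1 + d * s) := by
              rw [pow_add, pow_mul]; simp
          _ ≤ 2 ^ (s * (1 + d)) := by
              apply pow_le_pow_right₀ (by norm_num); nlinarith
          _ = _ := by rw [pow_mul]
      have h4 : (0 : ℝ) < (2 ^ s) ^ (s.choose 2) := by positivity
      push_cast
      rw [one_div, inv_pow, ← div_eq_mul_inv, div_le_iff₀ h4]
      linarith)
    (by
      have h1 : (n : ℝ) ≤ 2 ^ (s.choose 2 - 1) := by exact_mod_cast hn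
      have h2 : (n : ℝ) ^ t ≤ (2 ^ (s.choose 2 - 1)) ^ t := by gcongr
      set C := s.choose 2 with hC
      set m : ℕ := 2 ^ s with hm
      have hm2 : 2 ≤ m := by
        calc 2 = 2 ^ 1 := rfl
          _ ≤ 2 ^ s := Nat.pow_le_pow_right (by norm_num) hs
      have hm0 : (0 : ℝ) < m := by positivity
      have hx : (0 : ℝ) ≤ 1 - 1 / (m : ℝ) := by
        rw [sub_nonneg, div_le_one hm0]; exact_mod_cast (by omega : 1 ≤ m)
      have hx1 : 1 - 1 / (m : ℝ) ≤ 1 := by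
        have : (0 : ℝ) < 1 / m := by positivity
        linarith
      have hhalf : (1 - 1 / (m : ℝ)) ^ m ≤ 1 / 2 := by
        calc (1 - 1 / (m : ℝ)) ^ m ≤ (Real.exp (-(1 / (m : ℝ)))) ^ m := by
              gcongr
              have := Real.add_one_le_exp (-(1 / (m : ℝ)))
              linarith
          _ = Real.exp (-1) := by
              rw [← Real.exp_nat_mul]; congr 1; field_simp
          _ ≤ 1 / 2 := by
              rw [Real.exp_neg, one_div]
              apply inv_anti₀ (by norm_num)
              have := Real.add_one_le_exp (1 : ℝ)
              linarith
      have hsm : s < m := Nat.lt_two_pow_self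
      have hCm : 2 * C ≤ m * m := by
        have : C * 2 = s * (s - 1) := by
          rw [hC, Nat.choose_two_right]
          exact Nat.div_mul_cancel (Nat.even_mul_pred_self s).two_dvd
        have h5 : s * (s - 1) ≤ m * m := Nat.mul_le_mul hsm.le (by omega)
        omega
      have ht4 : m * m * m * m ≤ t := by
        refine le_trans (le_of_eq ?_) ht
        rw [hm]; ring
      have hmt : m * C * 2 + 1 ≤ t := by
        have e1 : m * (2 * C) ≤ m * (m * m) := Nat.mul_le_mul_left _ hCm
        have e2 : m * m * m * 2 ≤ m * m * m * m := Nat.mul_le_mul_left _ hm2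
        have e3 : 0 < m * m * m := by positivity
        nlinarith
      have hct : m * (C * t) ≤ t.choose 2 := by
        rw [Nat.choose_two_right, Nat.le_div_iff_mul_le (by norm_num)]
        have : m * C * 2 ≤ t - 1 := by omega
        calc m * (C * t) * 2 = t * (m * C * 2) := by ring
          _ ≤ t * (t - 1) := Nat.mul_le_mul_left _ this
      have h5 : (1 - 1 / (m : ℝ)) ^ (t.choose 2) ≤ (1 / 2) ^ (C * t) := by
        calc (1 - 1 / (m : ℝ)) ^ (t.choose 2) ≤ (1 - 1 / (m : ℝ)) ^ (m * (C * t)) :=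
              pow_le_pow_of_le_one hx hx1 hct
          _ = ((1 - 1 / (m : ℝ)) ^ m) ^ (C * t) := by rw [pow_mul]
          _ ≤ _ := by gcongr
      have ht2 : 2 ≤ t := by
        have : 1 ≤ m * C := Nat.mul_pos (by omega) hc
        omega
      calc (n : ℝ) ^ t * (1 - 1 / (m : ℝ)) ^ (t.choose 2)
          ≤ (2 ^ (C - 1)) ^ t * (1 / 2) ^ (C * t) := by gcongr
        _ = (1 / 2) ^ t := by
            obtain ⟨d, hd⟩ := Nat.exists_eq_add_of_le hc
            rw [hd, ← pow_mul, add_mul, pow_add]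
            simp
            field_simp
        _ ≤ (1 / 2) ^ 2 := pow_le_pow_of_le_one (by norm_num) (by norm_num) ht2
        _ < 1 / 2 := by norm_num)
  refine ⟨fun i j => ∃ (hi : i < n) (hj : j < n), f s(⟨i, hi⟩, ⟨j, hj⟩), ?_, ?_, ?_⟩
  · rintro i j ⟨hi, hj, h⟩
    exact ⟨hj, hi, by rwa [Sym2.eq_swap]⟩
  · intro K hK hKs
    obtain ⟨i, hi, j, hj, hij, h⟩ := hf1 (K.attachFin hK) (by simpa using hKs)
    refine ⟨i, by simpa using hi, j, by simpa using hj, by simpa [Fin.ext_iff] using hij, ?_⟩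
    rintro ⟨_, _, h'⟩
    exact h h'
  · intro K hK hKs
    obtain ⟨i, hi, j, hj, hij, h⟩ := hf2 (K.attachFin hK) (by simpa using hKs)
    exact ⟨i, by simpa using hi, j, by simpa using hj, by simpa [Fin.ext_iff] using hij,
      i.2, j.2, h⟩


/-- Least `k` such that `a` and `b` agree after dropping the last `k` bits. -/
noncomputable def dl (a b : ℕ) : ℕ := sInf {k | a / 2 ^ k = b / 2 ^ k}

lemma dl_le_iff (a b k : ℕ) : dl a b ≤ k ↔ a / 2 ^ k = b / 2 ^ k := by
  have hne : {k | a / 2 ^ k = b / 2 ^ k}.Nonempty := by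
    refine ⟨a + b, ?_⟩
    have h1 : a + b < 2 ^ (a + b) := Nat.lt_two_pow_self
    simp only [Set.mem_ofPred_eq]
    rw [Nat.div_eq_of_lt (by omega), Nat.div_eq_of_lt (by omega)]
  constructor
  · intro h
    have h1 : a / 2 ^ (dl a b) = b / 2 ^ (dl a b) := Nat.sInf_mem hne
    obtain ⟨d, rfl⟩ := Nat.exists_eq_add_of_le h
    rw [pow_add, ← Nat.div_div_eq_div_mul, ← Nat.div_div_eq_div_mul, h1]
  · intro h
    exact Nat.sInf_le h

lemma dl_ne {a b c : ℕ} (hab : a < b) (hbc : b < c) : dl a b ≠ dl b c := by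
  intro h
  rcases hk : dl a b with _ | k
  · have := (dl_le_iff a b 0).1 hk.le
    simp at this; omega
  · have h1 := (dl_le_iff a b (k+1)).1 hk.le
    have h2 := (dl_le_iff b c (k+1)).1 (h ▸ hk).le
    have h3 : ¬ a / 2 ^ k = b / 2 ^ k := by rw [← dl_le_iff]; omega
    have h4 : ¬ b / 2 ^ k = c / 2 ^ k := by rw [← dl_le_iff]; omega
    have h5 : a / 2 ^ k ≤ b / 2 ^ k := Nat.div_le_div_right hab.le
    have h6 : b / 2 ^ k ≤ c / 2 ^ k := Nat.div_le_div_right hbc.le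
    rw [pow_succ, ← Nat.div_div_eq_div_mul, ← Nat.div_div_eq_div_mul] at h1 h2
    omega

lemma dl_max {a b c : ℕ} (hab : a ≤ b) (hbc : b ≤ c) : dl a c = max (dl a b) (dl b c) := by
  apply le_antisymm
  · rw [dl_le_iff]
    exact ((dl_le_iff _ _ _).1 (le_max_left _ _)).trans ((dl_le_iff _ _ _).1 (le_max_right _ _))
  · have h := (dl_le_iff a c _).1 le_rfl
    have h5 : a / 2 ^ (dl a c) ≤ b / 2 ^ (dl a c) := Nat.div_le_div_right hab
    have h6 : b / 2 ^ (dl a c) ≤ c / 2 ^ (dl a c) := Nat.div_le_div_right hbc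
    rw [max_le_iff, dl_le_iff, dl_le_iff]
    omega

/-- A set all of whose triples are blue yields a large blue clique. -/
lemma blue_tree (B : ℕ → ℕ → Prop) (hsymm : ∀ i j, B i j → B j i) (M : ℕ) :
    ∀ S : Finset ℕ, (∀ x ∈ S, ∀ y ∈ S, x / 2 ^ M = y / 2 ^ M) →
      (∀ a ∈ S, ∀ b ∈ S, ∀ c ∈ S, a < b → b < c → B (dl a b) (dl b c)) →
      ∃ K : Finset ℕ, S.card ≤ 2 ^ K.card ∧ (∀ k ∈ K, ∃ a ∈ S, ∃ b ∈ S, a < b ∧ dl a b = k) ∧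
        (∀ i ∈ K, ∀ j ∈ K, i ≠ j → B i j) := by
  induction M with
  | zero =>
    intro S hS _
    refine ⟨∅, ?_, by simp, by simp⟩
    simpa [Finset.card_le_one] using hS
  | succ M ih =>
    intro S hS hB
    let L := S.filter (fun x => x / 2 ^ M % 2 = 0)
    let U := S.filter (fun x => ¬ x / 2 ^ M % 2 = 0)
    have hcard : L.card + U.card = S.card := Finset.card_filter_add_card_filter_not _
    have hS' : ∀ x ∈ S, ∀ y ∈ S, x / 2 ^ M / 2 = y / 2 ^ M / 2 := by
      intro x hx y hy
      have := hS x hx y hy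
      rwa [pow_succ, ← Nat.div_div_eq_div_mul, ← Nat.div_div_eq_div_mul] at this
    have hL : ∀ x ∈ L, ∀ y ∈ L, x / 2 ^ M = y / 2 ^ M := by
      intro x hx y hy
      have hx := Finset.mem_filter.1 hx
      have hy := Finset.mem_filter.1 hy
      have := hS' x hx.1 y hy.1
      omega
    have hU : ∀ x ∈ U, ∀ y ∈ U, x / 2 ^ M = y / 2 ^ M := by
      intro x hx y hy
      have hx := Finset.mem_filter.1 hx
      have hy := Finset.mem_filter.1 hy
      have := hS' x hx.1 y hy.1
      omega
    have hLS : L ⊆ S := Finset.filter_subset _ _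
    have hUS : U ⊆ S := Finset.filter_subset _ _
    have hLU : ∀ x ∈ L, ∀ y ∈ U, x < y ∧ dl x y = M + 1 := by
      intro x hx y hy
      have hx := Finset.mem_filter.1 hx
      have hy := Finset.mem_filter.1 hy
      have h1 := hS' x hx.1 y hy.1
      have h2 : x / 2 ^ M < y / 2 ^ M := by omega
      refine ⟨?_, ?_⟩
      · by_contra h
        have : y / 2 ^ M ≤ x / 2 ^ M := Nat.div_le_div_right (by omega)
        omega
      · apply le_antisymm
        · exact (dl_le_iff _ _ _).2 (hS x hx.1 y hy.1)
        · by_contra h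
          have := (dl_le_iff x y M).1 (by omega)
          omega
    obtain ⟨KL, cL, wL, bL⟩ := ih L hL (fun a ha b hb c hc =>
      hB a (hLS ha) b (hLS hb) c (hLS hc))
    obtain ⟨KU, cU, wU, bU⟩ := ih U hU (fun a ha b hb c hc =>
      hB a (hUS ha) b (hUS hb) c (hUS hc))
    have key : ∀ (T K : Finset ℕ), T ⊆ S → (∀ x ∈ T, ∀ y ∈ T, x / 2 ^ M = y / 2 ^ M) →
        S.card ≤ 2 * T.card →
        T.card ≤ 2 ^ K.card → (∀ k ∈ K, ∃ a ∈ T, ∃ b ∈ T, a < b ∧ dl a b = k) →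
        (∀ i ∈ K, ∀ j ∈ K, i ≠ j → B i j) →
        (∃ x ∈ S, ∃ y ∈ S, x < y ∧ dl x y = M + 1) →
        (∀ a ∈ T, ∀ b ∈ T, a < b → B (dl a b) (M + 1)) →
        ∃ K : Finset ℕ, S.card ≤ 2 ^ K.card ∧
        (∀ k ∈ K, ∃ a ∈ S, ∃ b ∈ S, a < b ∧ dl a b = k) ∧
        (∀ i ∈ K, ∀ j ∈ K, i ≠ j → B i j) := by
      intro T K hTS hT hc cK wK bK hM hTB
      have hnot : M + 1 ∉ K := by
        intro h
        obtain ⟨a, ha, b, hb, _, hk⟩ := wK _ h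
        have := (dl_le_iff a b M).2 (hT a ha b hb)
        omega
      refine ⟨insert (M + 1) K, ?_, ?_, ?_⟩
      · rw [Finset.card_insert_of_notMem hnot, pow_succ]; omega
      · intro k hk
        rcases Finset.mem_insert.1 hk with rfl | hk
        · exact hM
        · obtain ⟨a, ha, b, hb, h⟩ := wK _ hk
          exact ⟨a, hTS ha, b, hTS hb, h⟩
      · intro i hi j hj hij
        rcases Finset.mem_insert.1 hi with rfl | hi <;> rcases Finset.mem_insert.1 hj with rfl | hj
        · exact absurd rfl hij
        · obtain ⟨a, ha, b, hb, h, rfl⟩ := wK _ hj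
          exact hsymm _ _ (hTB a ha b hb h)
        · obtain ⟨a, ha, b, hb, h, rfl⟩ := wK _ hi
          exact hTB a ha b hb h
        · exact bK i hi j hj hij
    rcases L.eq_empty_or_nonempty with hLe | ⟨x, hx⟩
    · refine ⟨KU, ?_, ?_, bU⟩
      · rw [hLe] at hcard; simp at hcard; omega
      · intro k hk
        obtain ⟨a, ha, b, hb, h⟩ := wU _ hk
        exact ⟨a, hUS ha, b, hUS hb, h⟩
    rcases U.eq_empty_or_nonempty with hUe | ⟨y, hy⟩
    · refine ⟨KL, ?_, ?_, bL⟩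
      · rw [hUe] at hcard; simp at hcard; omega
      · intro k hk
        obtain ⟨a, ha, b, hb, h⟩ := wL _ hk
        exact ⟨a, hLS ha, b, hLS hb, h⟩
    have hM : ∃ x ∈ S, ∃ y ∈ S, x < y ∧ dl x y = M + 1 :=
      ⟨x, hLS hx, y, hUS hy, hLU x hx y hy⟩
    rcases le_total L.card U.card with h | h
    · refine key U KU hUS hU (by omega) cU wU bU hM ?_
      intro a ha b hb hab
      have h1 := hLU x hx a ha
      have := hB x (hLS hx) a (hUS ha) b (hUS hb) h1.1 hab
      rw [h1.2] at this
      exact hsymm _ _ this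
    · refine key L KL hLS hL (by omega) cL wL bL hM ?_
      intro a ha b hb hab
      have h1 := hLU b hb y hy
      have := hB a (hLS ha) b (hLS hb) y (hUS hy) hab h1.1
      rwa [h1.2] at this

lemma exists_chi {N : ℕ} (g : ℕ → ℕ → ℕ → Fin 3) :
    ∃ χ : Finset (Fin N) → Fin 3, ∀ a b c : Fin N, a < b → b < c →
      χ {a, b, c} = g a b c := by
  refine ⟨fun t => match t.sort (· ≤ ·) with
    | [a, b, c] => g a b c
    | _ => 0, ?_⟩
  intro a b c hab hbc
  have h : ({a, b, c} : Finset (Fin N)).sort (· ≤ ·) = [a, b, c] := by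
    have hac := hab.trans hbc
    have h1 : ({a, b, c} : Finset (Fin N)) = [a, b, c].toFinset := by simp
    rw [h1, (List.toFinset_sort (· ≤ ·) (by simp [hab.ne, hbc.ne, hac.ne]))]
    simp [hab.le, hbc.le, hac.le]
  simp only [h]

lemma step_up (B : ℕ → ℕ → Prop) (hsymm : ∀ i j, B i j → B j i) (M s l N : ℕ)
    (h1 : ∀ K : Finset ℕ, (∀ i ∈ K, i < M + 1) → K.card = s → ∃ i ∈ K, ∃ j ∈ K, i ≠ j ∧ ¬ B i j)
    (h2 : ∀ K : Finset ℕ, (∀ i ∈ K, i < M + 1) → K.card = l - 1 →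
      ∃ i ∈ K, ∃ j ∈ K, i ≠ j ∧ B i j)
    (hl : 2 ^ s ≤ l) (hN : N ≤ 2 ^ M) :
    ∃ χ : Finset (Fin N) → Fin 3,
        ¬ ∃ (S : Finset (Fin N)) (i : Fin 3), S.card = l ∧
            ∀ t ⊆ S, t.card = 3 → χ t = i := by
  classical
  obtain ⟨χ, hχ⟩ := exists_chi (N := N) (fun a b c =>
    if B (dl a b) (dl b c) then 2 else if dl a b < dl b c then 0 else 1)
  refine ⟨χ, ?_⟩
  rintro ⟨S0, col, hcard0, hmono0⟩
  let S : Finset ℕ := Finset.image (fun x : Fin N => (x : ℕ)) S0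
  have hcard : S.card = l := by
    rw [Finset.card_image_of_injective _ Fin.val_injective, hcard0]
  have hSN : ∀ x ∈ S, x < 2 ^ M := by
    intro x hx
    obtain ⟨y, _, rfl⟩ := Finset.mem_image.1 hx
    exact y.2.trans_le hN
  have hdl : ∀ x ∈ S, ∀ y ∈ S, dl x y < M + 1 := by
    intro x hx y hy
    rw [Nat.lt_succ_iff, dl_le_iff, Nat.div_eq_of_lt (hSN x hx), Nat.div_eq_of_lt (hSN y hy)]
  have hmono : ∀ a ∈ S, ∀ b ∈ S, ∀ c ∈ S, a < b → b < c →
      (if B (dl a b) (dl b c) then (2 : Fin 3) else if dl a b < dl b c then 0 else 1) = col := by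
    intro a ha b hb c hc hab hbc
    obtain ⟨a, ha, rfl⟩ := Finset.mem_image.1 ha
    obtain ⟨b, hb, rfl⟩ := Finset.mem_image.1 hb
    obtain ⟨c, hc, rfl⟩ := Finset.mem_image.1 hc
    have hab' : a < b := hab
    have hbc' : b < c := hbc
    rw [← hχ a b c hab hbc]
    apply hmono0
    · intro x hx
      simp only [Finset.mem_insert, Finset.mem_singleton] at hx
      rcases hx with rfl | rfl | rfl <;> assumption
    · exact Finset.card_eq_three.2 ⟨a, b, c, hab'.ne, (hab'.trans hbc').ne, hbc'.ne, rfl⟩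
  have hl0 : 0 < l := lt_of_lt_of_le (by positivity) hl
  have hne : S.Nonempty := by rw [← Finset.card_pos]; omega
  -- common argument for the two red colours
  have red : ∀ (z : ℕ) (d : ℕ → ℕ), z ∈ S → (∀ b ∈ S.erase z, d b < M + 1) →
      (∀ b ∈ S.erase z, ∀ c ∈ S.erase z, b < c → d b ≠ d c ∧ ¬ B (d b) (d c)) → False := by
    intro z d hz hd hB
    have hinj : Set.InjOn d (S.erase z : Finset ℕ) := by
      intro b hb c hc hbc
      rcases lt_trichotomy b c with h | h | h
      · exact absurd hbc (hB b hb c hc h).1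
      · exact h
      · exact absurd hbc.symm (hB c hc b hb h).1
    obtain ⟨i, hi, j, hj, hij, hBij⟩ := h2 ((S.erase z).image d) (by
      intro i hi
      obtain ⟨b, hb, rfl⟩ := Finset.mem_image.1 hi
      exact hd b hb) (by
      rw [Finset.card_image_of_injOn hinj, Finset.card_erase_of_mem hz, hcard])
    obtain ⟨b, hb, rfl⟩ := Finset.mem_image.1 hi
    obtain ⟨c, hc, rfl⟩ := Finset.mem_image.1 hj
    rcases lt_trichotomy b c with h | h | h
    · exact (hB b hb c hc h).2 hBij
    · exact hij (by rw [h])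
    · exact (hB c hc b hb h).2 (hsymm _ _ hBij)
  have hcol : col = 0 ∨ col = 1 ∨ col = 2 := by
    clear hmono hmono0
    revert col; decide
  rcases hcol with rfl | rfl | rfl
  · have hm : ∀ a ∈ S, ∀ b ∈ S, ∀ c ∈ S, a < b → b < c →
        ¬ B (dl a b) (dl b c) ∧ dl a b < dl b c := by
      intro a ha b hb c hc hab hbc
      have := hmono a ha b hb c hc hab hbc
      split_ifs at this with h h'
      · exact absurd this (by decide)
      · exact ⟨h, h'⟩
      · exact absurd this (by decide)
    have hz := S.min'_mem hne
    refine red (S.min' hne) (fun b => dl (S.min' hne) b) hz ?_ ?_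
    · intro b hb
      exact hdl _ hz _ (Finset.mem_of_mem_erase hb)
    · intro b hb c hc hbc
      have hlt : S.min' hne < b := S.min'_lt_of_mem_erase_min' hne hb
      have h := hm _ hz b (Finset.mem_of_mem_erase hb) c (Finset.mem_of_mem_erase hc) hlt hbc
      have e : dl (S.min' hne) c = dl b c := by
        rw [dl_max hlt.le hbc.le]; exact max_eq_right h.2.le
      simp only [e]
      exact ⟨h.2.ne, h.1⟩
  · have hm : ∀ a ∈ S, ∀ b ∈ S, ∀ c ∈ S, a < b → b < c →
        ¬ B (dl a b) (dl b c) ∧ dl b c < dl a b := by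
      intro a ha b hb c hc hab hbc
      have := hmono a ha b hb c hc hab hbc
      have hne := dl_ne hab hbc
      split_ifs at this with h h'
      · exact absurd this (by decide)
      · exact absurd this (by decide)
      · exact ⟨h, by omega⟩
    have hz := S.max'_mem hne
    refine red (S.max' hne) (fun b => dl b (S.max' hne)) hz ?_ ?_
    · intro b hb
      exact hdl _ (Finset.mem_of_mem_erase hb) _ hz
    · intro b hb c hc hbc
      have hlt : c < S.max' hne := S.lt_max'_of_mem_erase_max' hne hc
      have h := hm b (Finset.mem_of_mem_erase hb) c (Finset.mem_of_mem_erase hc) _ hz hbc hlt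
      have e : dl b (S.max' hne) = dl b c := by
        rw [dl_max hbc.le hlt.le]; exact max_eq_left h.2.le
      simp only [e]
      exact ⟨h.2.ne', h.1⟩
  · obtain ⟨K, cK, wK, bK⟩ := blue_tree B hsymm M S (by
      intro x hx y hy
      rw [Nat.div_eq_of_lt (hSN x hx), Nat.div_eq_of_lt (hSN y hy)]) (by
      intro a ha b hb c hc hab hbc
      have := hmono a ha b hb c hc hab hbc
      split_ifs at this with h h'
      · exact h
      · exact absurd this (by decide)
      · exact absurd this (by decide))
    have hsK : s ≤ K.card := by
      have : 2 ^ s ≤ 2 ^ K.card := by omega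
      exact (Nat.pow_le_pow_iff_right (by norm_num)).1 this
    obtain ⟨K', hK', hc'⟩ := Finset.exists_subset_card_eq hsK
    obtain ⟨i, hi, j, hj, hij, h⟩ := h1 K' (by
      intro i hi
      obtain ⟨a, ha, b, hb, _, rfl⟩ := wK i (hK' hi)
      exact hdl a ha b hb) hc'
    exact h (bK i (hK' hi) j (hK' hj) hij)

/-- **Theorem 1 (lower bound for 3-colour 3-uniform hypergraph Ramsey numbers).**
There is an absolute constant `c > 0` such that for all sufficiently large `l`,
`r₃(l,l,l) ≥ 2 ^ (l ^ (c · log₂ log₂ l))`; equivalently, every `N` below that bound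
admits a 3-colouring of the 3-element subsets of `{1,…,N}` with no set of `l`
vertices all of whose 3-element subsets get the same colour. -/
theorem three_colour_ramsey_lower_bound :
    ∃ c : ℝ, 0 < c ∧ ∀ᶠ l : ℕ in atTop, ∀ N : ℕ,
      (N : ℝ) < (2 : ℝ) ^ ((l : ℝ) ^ (c * Real.logb 2 (Real.logb 2 l))) →
      ∃ χ : Finset (Fin N) → Fin 3,
        ¬ ∃ (S : Finset (Fin N)) (i : Fin 3), S.card = l ∧
            ∀ t ⊆ S, t.card = 3 → χ t = i := by
  refine ⟨1 / 1024, by norm_num, ?_⟩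
  filter_upwards [eventually_ge_atTop (2 ^ 32)] with l hl N hN
  have hl0 : l ≠ 0 := by
    rintro rfl
    norm_num at hl
  set n := Nat.log 2 l with hn
  have hn32 : 32 ≤ n := Nat.le_log_of_pow_le (by norm_num) hl
  have hnl : 2 ^ n ≤ l := Nat.pow_log_le_self 2 hl0
  have hln : l < 2 ^ (n + 1) := Nat.lt_pow_succ_log_self (by norm_num) l
  set s := n / 8 with hs
  have hs4 : 4 ≤ s := by omega
  have hC : s * (s - 1) = s.choose 2 * 2 := by
    rw [Nat.choose_two_right]
    exact (Nat.div_mul_cancel (Nat.even_mul_pred_self s).two_dvd).symm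
  have hC2 : s * s ≤ 4 * (s.choose 2 - 2) ∧ 2 ≤ s.choose 2 := by
    obtain ⟨d, hd⟩ := Nat.exists_eq_add_of_le hs4
    have e : s - 1 = 3 + d := by omega
    rw [e] at hC
    have : s * s + 8 ≤ 4 * s.choose 2 := by nlinarith
    have : 16 ≤ s * s := by nlinarith
    omega
  set C := s.choose 2 with hCdef
  have h4s : 2 ^ (4 * s) ≤ l - 1 := by
    have : 2 ^ (4 * s + 1) ≤ 2 ^ n := Nat.pow_le_pow_right (by norm_num) (by omega)
    have h1 : 1 ≤ 2 ^ (4 * s) := Nat.one_le_two_pow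
    rw [pow_succ] at this
    omega
  have hsl : 2 ^ s ≤ l :=
    (Nat.pow_le_pow_right (by norm_num) (by omega : s ≤ n)).trans hnl
  have hM : 2 ^ (C - 2) + 1 ≤ 2 ^ (C - 1) := by
    have e : C - 1 = (C - 2) + 1 := by omega
    have h1 : 1 ≤ 2 ^ (C - 2) := Nat.one_le_two_pow
    rw [e, pow_succ]
    omega
  obtain ⟨B, hsymm, h1, h2⟩ := exists_graph (2 ^ (C - 2) + 1) s (l - 1) (by omega) (by omega) hM h4s
  refine step_up B hsymm (2 ^ (C - 2)) s l N h1 h2 hsl ?_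
  have hlpos : (0 : ℝ) < l := by exact_mod_cast Nat.pos_of_ne_zero hl0
  set L := Real.logb 2 l with hL
  have hlL : (l : ℝ) = 2 ^ L := (Real.rpow_logb (by norm_num) (by norm_num) hlpos).symm
  have hL1 : 1 ≤ L := by
    rw [hL, Real.le_logb_iff_rpow_le (by norm_num) hlpos, Real.rpow_one]
    exact_mod_cast (le_trans (by norm_num) hl : 2 ≤ l)
  have hL16 : L ≤ 16 * s := by
    rw [hL, Real.logb_le_iff_le_rpow (by norm_num) hlpos]
    have h3 : l ≤ 2 ^ (16 * s) :=
      hln.le.trans (Nat.pow_le_pow_right (by norm_num) (by omega))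
    have h4 : (l : ℝ) ≤ (2 : ℝ) ^ (16 * s) := by exact_mod_cast h3
    rw [← Real.rpow_natCast] at h4
    simpa using h4
  have hLL : Real.logb 2 L ≤ L := by
    rw [Real.logb_le_iff_le_rpow (by norm_num) (by linarith), ← hlL]
    rw [hL, Real.logb_le_iff_le_rpow (by norm_num) hlpos, Real.rpow_natCast]
    exact_mod_cast (Nat.lt_two_pow_self (n := l)).le
  have hexp : L * (1 / 1024 * Real.logb 2 L) ≤ ((C - 2 : ℕ) : ℝ) := by
    have e1 : ((s * s : ℕ) : ℝ) ≤ ((4 * (C - 2) : ℕ) : ℝ) := by exact_mod_cast hC2.1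
    rw [Nat.cast_mul, Nat.cast_mul] at e1
    have e2 : L * Real.logb 2 L ≤ L * L := by gcongr
    have e3 : L * L ≤ (16 * s) * (16 * s) := by gcongr
    push_cast at e1
    nlinarith
  have hfin : (l : ℝ) ^ (1 / 1024 * Real.logb 2 L) ≤ ((2 ^ (C - 2) : ℕ) : ℝ) := by
    rw [hlL, ← Real.rpow_mul (by norm_num)]
    calc (2 : ℝ) ^ (L * (1 / 1024 * Real.logb 2 L)) ≤ (2 : ℝ) ^ ((C - 2 : ℕ) : ℝ) :=
          Real.rpow_le_rpow_of_exponent_le (by norm_num) hexp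
      _ = _ := by rw [Real.rpow_natCast]; push_cast; rfl
  have hN2 : (N : ℝ) ≤ (2 : ℝ) ^ (2 ^ (C - 2) : ℕ) := by
    rw [← Real.rpow_natCast]
    exact hN.le.trans (Real.rpow_le_rpow_of_exponent_le (by norm_num) hfin)
  exact_mod_cast hN2
end

section
/- For every integer k ≥ 3 there is a constant c > 0 (depending on k) such that for all sufficiently large l, r_k(l,l,l) ≥ twr_{k−2}(l^(c·log log l)), where twr_0(x) = x and twr_{j+1}(x) = 2^(twr_j(x)); that is, r_k(l,l,l) is at least a tower of 2's of height k−2 topped by l^(c·log log l) (a tower of total height k in the paper's counting). -/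
open Filter

/-- The tower function: `twr 0 x = x` and `twr (j+1) x = 2 ^ (twr j x)`. -/
noncomputable def twr : ℕ → ℝ → ℝ
  | 0, x => x
  | (j + 1), x => (2 : ℝ) ^ (twr j x)

namespace StepUp

theorem dl_ex (a b : ℕ) : ∃ j, a / 2 ^ j = b / 2 ^ j := by
  refine ⟨a + b, ?_⟩
  have h : a + b < 2 ^ (a + b) := Nat.lt_two_pow_self
  rw [Nat.div_eq_of_lt (by omega), Nat.div_eq_of_lt (by omega)]

/-- position of the highest binary digit where `a` and `b` differ, counted from 1 -/
def dl (a b : ℕ) : ℕ := Nat.find (dl_ex a b)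

theorem dl_le_iff (a b j : ℕ) : dl a b ≤ j ↔ a / 2 ^ j = b / 2 ^ j := by
  unfold dl
  constructor
  · intro h
    have h1 := Nat.find_spec (dl_ex a b)
    obtain ⟨d, rfl⟩ := Nat.exists_eq_add_of_le h
    rw [pow_add, ← Nat.div_div_eq_div_mul, ← Nat.div_div_eq_div_mul, h1]
  · intro h
    exact Nat.find_min' _ h

theorem dl_comm (a b : ℕ) : dl a b = dl b a := by
  apply le_antisymm
  · rw [dl_le_iff, ((dl_le_iff b a _).1 le_rfl)]
  · rw [dl_le_iff, ((dl_le_iff a b _).1 le_rfl)]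

theorem dl_pos {a b : ℕ} (h : a < b) : 0 < dl a b := by
  by_contra h0
  have := (dl_le_iff a b 0).1 (by omega)
  simp at this
  omega

theorem dl_max {a b c : ℕ} (h : a < b) (h' : b < c) : dl a c = max (dl a b) (dl b c) := by
  have key : ∀ j, dl a c ≤ j ↔ max (dl a b) (dl b c) ≤ j := by
    intro j
    rw [max_le_iff, dl_le_iff, dl_le_iff, dl_le_iff]
    have h1 : a / 2 ^ j ≤ b / 2 ^ j := Nat.div_le_div_right h.le
    have h2 : b / 2 ^ j ≤ c / 2 ^ j := Nat.div_le_div_right h'.le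
    omega
  exact le_antisymm ((key _).2 le_rfl) ((key _).1 le_rfl)

theorem dl_ne {a b c : ℕ} (h : a < b) (h' : b < c) : dl a b ≠ dl b c := by
  intro e
  have hp := dl_pos h
  obtain ⟨j, hj⟩ : ∃ j, dl a b = j + 1 := ⟨dl a b - 1, by omega⟩
  have h1 := (dl_le_iff a b (j + 1)).1 (by omega)
  have h2 := (dl_le_iff b c (j + 1)).1 (by omega)
  have h3 := (dl_le_iff a b j).not.1 (by omega)
  have h4 := (dl_le_iff b c j).not.1 (by omega)
  have h5 : a / 2 ^ j ≤ b / 2 ^ j := Nat.div_le_div_right h.le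
  have h6 : b / 2 ^ j ≤ c / 2 ^ j := Nat.div_le_div_right h'.le
  rw [pow_succ, ← Nat.div_div_eq_div_mul, ← Nat.div_div_eq_div_mul] at h1 h2
  omega

theorem dl_le {a b N : ℕ} (ha : a < 2 ^ N) (hb : b < 2 ^ N) : dl a b ≤ N := by
  rw [dl_le_iff, Nat.div_eq_of_lt ha, Nat.div_eq_of_lt hb]

/-- zero-based version -/
def de (a b : ℕ) : ℕ := dl a b - 1

theorem de_comm (a b : ℕ) : de a b = de b a := by rw [de, de, dl_comm]

theorem de_max {a b c : ℕ} (h : a < b) (h' : b < c) : de a c = max (de a b) (de b c) := by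
  have := dl_max h h'
  unfold de
  omega

theorem de_ne {a b c : ℕ} (h : a < b) (h' : b < c) : de a b ≠ de b c := by
  have := dl_ne h h'
  have := dl_pos h
  have := dl_pos h'
  unfold de
  omega

theorem de_lt {a b N : ℕ} (h : a < b) (hb : b < 2 ^ N) : de a b < N := by
  have := dl_le (h.trans hb) hb
  have := dl_pos h
  unfold de
  omega

/-- the set of all differences -/
def D (t : Finset ℕ) : Finset ℕ := t.offDiag.image (fun p => de p.1 p.2)

theorem mem_D {t : Finset ℕ} {x : ℕ} : x ∈ D t ↔ ∃ a ∈ t, ∃ b ∈ t, a < b ∧ de a b = x := by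
  simp only [D, Finset.mem_image, Finset.mem_offDiag, Prod.exists]
  constructor
  · rintro ⟨a, b, ⟨ha, hb, hab⟩, rfl⟩
    rcases lt_or_gt_of_ne hab with h | h
    · exact ⟨a, ha, b, hb, h, rfl⟩
    · exact ⟨b, hb, a, ha, h, de_comm _ _⟩
  · rintro ⟨a, ha, b, hb, h, rfl⟩
    exact ⟨a, b, ⟨ha, hb, h.ne⟩, rfl⟩

theorem D_sub {S : Finset ℕ} {N : ℕ} (h : S ⊆ Finset.range (2 ^ N)) : D S ⊆ Finset.range N := by
  intro x hx
  obtain ⟨a, ha, b, hb, hab, rfl⟩ := mem_D.1 hx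
  exact Finset.mem_range.2 (de_lt hab (Finset.mem_range.1 (h hb)))

theorem D_mono {S T : Finset ℕ} (h : S ⊆ T) : D S ⊆ D T := by
  intro x hx
  obtain ⟨a, ha, b, hb, hab, rfl⟩ := mem_D.1 hx
  exact mem_D.2 ⟨a, h ha, b, h hb, hab, rfl⟩

def Inc (t : Finset ℕ) : Prop :=
  ∀ a ∈ t, ∀ b ∈ t, ∀ c ∈ t, a < b → b < c → de a b < de b c

def Dec (t : Finset ℕ) : Prop :=
  ∀ a ∈ t, ∀ b ∈ t, ∀ c ∈ t, a < b → b < c → de b c < de a b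

theorem Inc.mono {s t : Finset ℕ} (h : Inc t) (hs : s ⊆ t) : Inc s :=
  fun a ha b hb c hc => h a (hs ha) b (hs hb) c (hs hc)

theorem Dec.mono {s t : Finset ℕ} (h : Dec t) (hs : s ⊆ t) : Dec s :=
  fun a ha b hb c hc => h a (hs ha) b (hs hb) c (hs hc)

/-- abstract comb lemma -/
theorem comb {V : Finset ℕ} {p : ℕ} (hp : p ∈ V)
    (hinj : ∀ a ∈ V, ∀ b ∈ V, a ≠ p → b ≠ p → de p a = de p b → a = b)
    (hd : ∀ a ∈ V, ∀ b ∈ V, a < b → (de a b = de p a ∧ a ≠ p) ∨ (de a b = de p b ∧ b ≠ p)) :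
    (D V).card + 1 = V.card ∧
      ∀ T ⊆ D V, ∃ t ⊆ V, t.card = T.card + 1 ∧ D t = T := by
  classical
  have gen : ∀ W ⊆ V, p ∈ W → D W = (W.erase p).image (de p) := by
    intro W hW hpW
    ext x
    rw [mem_D, Finset.mem_image]
    constructor
    · rintro ⟨a, ha, b, hb, hab, rfl⟩
      rcases hd a (hW ha) b (hW hb) hab with h | h
      · exact ⟨a, Finset.mem_erase.2 ⟨h.2, ha⟩, h.1.symm⟩
      · exact ⟨b, Finset.mem_erase.2 ⟨h.2, hb⟩, h.1.symm⟩
    · rintro ⟨a, ha, rfl⟩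
      obtain ⟨h1, h2⟩ := Finset.mem_erase.1 ha
      rcases lt_or_gt_of_ne h1 with h | h
      · exact ⟨a, h2, p, hpW, h, de_comm _ _⟩
      · exact ⟨p, hpW, a, h2, h, rfl⟩
  have cd : ∀ W ⊆ V, p ∈ W → (D W).card + 1 = W.card := by
    intro W hW hpW
    rw [gen W hW hpW, Finset.card_image_of_injOn, Finset.card_erase_add_one hpW]
    intro a ha b hb hab
    have ha := Finset.mem_erase.1 (Finset.mem_coe.1 ha)
    have hb := Finset.mem_erase.1 (Finset.mem_coe.1 hb)
    exact hinj a (hW ha.2) b (hW hb.2) ha.1 hb.1 hab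
  refine ⟨cd V subset_rfl hp, ?_⟩
  intro T hT
  have hsub : insert p ((V.erase p).filter (fun a => de p a ∈ T)) ⊆ V := by
    intro x hx
    rw [Finset.mem_insert, Finset.mem_filter, Finset.mem_erase] at hx
    rcases hx with rfl | h
    · exact hp
    · exact h.1.2
  have hDt : D (insert p ((V.erase p).filter (fun a => de p a ∈ T))) = T := by
    rw [gen _ hsub (Finset.mem_insert_self _ _)]
    ext x
    rw [Finset.mem_image]
    constructor
    · rintro ⟨a, ha, rfl⟩
      simp only [Finset.mem_erase, Finset.mem_insert, Finset.mem_filter] at ha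
      tauto
    · intro hx
      have := hT hx
      rw [gen V subset_rfl hp, Finset.mem_image] at this
      obtain ⟨a, ha, rfl⟩ := this
      refine ⟨a, ?_, rfl⟩
      simp only [Finset.mem_erase, Finset.mem_insert, Finset.mem_filter] at ha ⊢
      tauto
  refine ⟨_, hsub, ?_, hDt⟩
  rw [← cd _ hsub (Finset.mem_insert_self _ _), hDt]

theorem comb_inc {V : Finset ℕ} (h0 : V.Nonempty) (h : Inc V) :
    (D V).card + 1 = V.card ∧
      ∀ T ⊆ D V, ∃ t ⊆ V, t.card = T.card + 1 ∧ D t = T := by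
  have hm : ∀ a ∈ V, a ≠ V.min' h0 → V.min' h0 < a := fun a ha hne =>
    lt_of_le_of_ne (Finset.min'_le _ _ ha) hne.symm
  have hp := Finset.min'_mem V h0
  refine comb hp ?_ ?_
  · intro a ha b hb hap hbp e
    have h1 := hm a ha hap
    have h2 := hm b hb hbp
    rcases lt_trichotomy a b with h3 | h3 | h3
    · have := h _ hp _ ha _ hb h1 h3
      have := de_max h1 h3
      omega
    · exact h3
    · have := h _ hp _ hb _ ha h2 h3
      have := de_max h2 h3
      omega
  · intro a ha b hb hab
    right
    by_cases hap : a = V.min' h0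
    · rw [← hap]
      exact ⟨rfl, hab.ne'⟩
    · have h1 := hm a ha hap
      have := h _ hp _ ha _ hb h1 hab
      have := de_max h1 hab
      refine ⟨by omega, by omega⟩

theorem comb_dec {V : Finset ℕ} (h0 : V.Nonempty) (h : Dec V) :
    (D V).card + 1 = V.card ∧
      ∀ T ⊆ D V, ∃ t ⊆ V, t.card = T.card + 1 ∧ D t = T := by
  have hm : ∀ a ∈ V, a ≠ V.max' h0 → a < V.max' h0 := fun a ha hne =>
    lt_of_le_of_ne (Finset.le_max' _ _ ha) hne
  have hp := Finset.max'_mem V h0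
  refine comb hp ?_ ?_
  · intro a ha b hb hap hbp e
    have h1 := hm a ha hap
    have h2 := hm b hb hbp
    rw [de_comm _ a, de_comm _ b] at e
    rcases lt_trichotomy a b with h3 | h3 | h3
    · have := h _ ha _ hb _ hp h3 h2
      have := de_max h3 h2
      omega
    · exact h3
    · have := h _ hb _ ha _ hp h3 h1
      have := de_max h3 h1
      omega
  · intro a ha b hb hab
    left
    by_cases hbp : b = V.max' h0
    · rw [← hbp]
      exact ⟨de_comm _ _, hab.ne⟩
    · have h1 := hm b hb hbp
      have := h _ ha _ hb _ hp hab h1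
      have := de_max hab h1
      have := de_comm a (V.max' h0)
      refine ⟨by omega, by omega⟩

/-- colouring of `k`-sets below `N` without monochromatic sets of size `l` -/
def Good (k l N : ℕ) : Prop :=
  ∃ χ : Finset ℕ → Fin 3, ∀ S ⊆ Finset.range N, ∀ i : Fin 3,
    (∀ t ⊆ S, t.card = k → χ t = i) → S.card < l

theorem Good.mono {k l N l' : ℕ} (h : Good k l N) (hl : l ≤ l') : Good k l' N := by
  obtain ⟨χ, h⟩ := h
  exact ⟨χ, fun S hS i hi => (h S hS i hi).trans_le hl⟩

theorem top_part (S : Finset ℕ) (j : ℕ) (hj : j ≤ S.card) :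
    ∃ L ⊆ S, L.card = j ∧ ∀ x ∈ S \ L, ∀ y ∈ L, x < y := by
  induction j with
  | zero => exact ⟨∅, by simp, by simp, by simp⟩
  | succ j ih =>
    obtain ⟨L, hL, hc, h⟩ := ih (by omega)
    have hne : (S \ L).Nonempty := by
      rw [← Finset.card_pos, Finset.card_sdiff_of_subset hL]
      omega
    have hmm := Finset.max'_mem _ hne
    have hmm' := Finset.mem_sdiff.1 hmm
    refine ⟨insert ((S \ L).max' hne) L, ?_, ?_, ?_⟩
    · intro x hx
      rcases Finset.mem_insert.1 hx with rfl | hx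
      · exact hmm'.1
      · exact hL hx
    · rw [Finset.card_insert_of_notMem hmm'.2, hc]
    · intro x hx y hy
      rw [Finset.mem_sdiff, Finset.mem_insert, not_or] at hx
      have hx' : x ∈ S \ L := Finset.mem_sdiff.2 ⟨hx.1, hx.2.2⟩
      rcases Finset.mem_insert.1 hy with rfl | hy
      · exact lt_of_le_of_ne (Finset.le_max' _ _ hx') hx.2.1
      · exact h x hx' y hy

/-- no local minimum: big monotone subset -/
theorem no_min {S : Finset ℕ}
    (h : ∀ a ∈ S, ∀ b ∈ S, ∀ c ∈ S, ∀ d ∈ S, a < b → b < c → c < d →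
      ¬ (de b c < de a b ∧ de b c < de c d)) :
    ∃ A ⊆ S, ∃ B ⊆ S, Inc A ∧ Dec B ∧ S.card ≤ A.card + B.card := by
  rcases S.eq_empty_or_nonempty with rfl | h0
  · exact ⟨∅, by simp, ∅, by simp, by simp [Inc], by simp [Dec], by simp⟩
  have hp := Finset.min'_mem S h0
  have hq := Finset.max'_mem S h0
  have hpm : ∀ a ∈ S, S.min' h0 ≤ a := fun a ha => Finset.min'_le _ _ ha
  have hqm : ∀ a ∈ S, a ≤ S.max' h0 := fun a ha => Finset.le_max' _ _ ha
  set p := S.min' h0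
  set q := S.max' h0
  refine ⟨S.filter (fun a => a = p ∨ de p a < de p q), Finset.filter_subset _ _,
    S.filter (fun a => ¬ (a = p ∨ de p a < de p q)), Finset.filter_subset _ _, ?_, ?_, ?_⟩
  · intro a ha b hb c hc hab hbc
    rw [Finset.mem_filter] at ha hb hc
    by_contra hcon
    have hne := de_ne hab hbc
    have hpc : p < c := by have := hpm a ha.1; omega
    have hcq : c < q := by
      rcases eq_or_lt_of_le (hqm c hc.1) with e | e
      · rcases hc.2 with h1 | h1
        · omega
        · rw [e] at h1; omega
      · exact e
    have h1 := de_max hpc hcq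
    have h2 : de p c < de p q := by rcases hc.2 with h1 | h1 <;> omega
    have h3 : de b c ≤ de p c := by
      have : p < b := by have := hpm a ha.1; omega
      have := de_max this hbc
      omega
    exact h a ha.1 b hb.1 c hc.1 q hq hab hbc hcq ⟨by omega, by omega⟩
  · intro a ha b hb c hc hab hbc
    rw [Finset.mem_filter, not_or, not_lt] at ha hb hc
    by_contra hcon
    have hne := de_ne hab hbc
    have hpa : p < a := by have := hpm a ha.1; omega
    have h1 := de_max hpa hab
    have h2 := de_ne hpa hab
    have h4 : de p b ≤ de p q := by
      rcases eq_or_lt_of_le (hqm b hb.1) with e | e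
      · rw [e]
      · have := de_max (hpa.trans hab) e
        omega
    exact h p hp a ha.1 b hb.1 c hc.1 hpa hab hbc ⟨by omega, by omega⟩
  · rw [Finset.card_filter_add_card_filter_not]

/-- no local maximum: big monotone subset -/
theorem no_max {S : Finset ℕ}
    (h : ∀ a ∈ S, ∀ b ∈ S, ∀ c ∈ S, ∀ d ∈ S, a < b → b < c → c < d →
      ¬ (de a b < de b c ∧ de c d < de b c)) :
    ∃ A ⊆ S, ∃ B ⊆ S, Inc A ∧ Dec B ∧ S.card ≤ A.card + B.card := by
  classical
  by_cases hs : ∃ a ∈ S, ∃ b ∈ S, a < b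
  swap
  · push Not at hs
    refine ⟨S, subset_rfl, S, subset_rfl, ?_, ?_, by omega⟩
    · intro a ha b hb c hc hab
      have := hs a ha b hb
      omega
    · intro a ha b hb c hc hab
      have := hs a ha b hb
      omega
  obtain ⟨a0, ha0, b0, hb0, hab0⟩ := hs
  have hne : (S.offDiag.filter (fun p => p.1 < p.2)).Nonempty :=
    ⟨(a0, b0), by simp [ha0, hb0, hab0, hab0.ne]⟩
  obtain ⟨⟨x, y⟩, hxy, hmin⟩ := Finset.exists_min_image _ (fun p : ℕ × ℕ => de p.1 p.2) hne
  simp only [Finset.mem_filter, Finset.mem_offDiag, Prod.forall, and_imp] at hxy hmin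
  obtain ⟨⟨hx, hy, -⟩, hlt⟩ := hxy
  have hm : ∀ a ∈ S, ∀ b ∈ S, a < b → de x y ≤ de a b := fun a ha b hb hab =>
    hmin a b ha hb hab.ne hab
  have hcons : ∀ z ∈ S, x < z → z < y → False := by
    intro z hz h1 h2
    have := de_max h1 h2
    have := de_ne h1 h2
    have := hm x hx z hz h1
    have := hm z hz y hy h2
    omega
  refine ⟨S.filter (fun a => y ≤ a), Finset.filter_subset _ _,
    S.filter (fun a => ¬ (y ≤ a)), Finset.filter_subset _ _, ?_, ?_, ?_⟩
  · intro a ha b hb c hc hab hbc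
    rw [Finset.mem_filter] at ha hb hc
    by_contra hcon
    have hne := de_ne hab hbc
    have hyb : y < b := by omega
    have h1 : de a b ≤ de y b := by
      rcases eq_or_lt_of_le ha.2 with e | e
      · rw [e]
      · have := de_max e hab
        omega
    have := hm y hy b hb.1 hyb
    have := de_ne hlt hyb
    exact h x hx y hy b hb.1 c hc.1 hlt hyb hbc ⟨by omega, by omega⟩
  · intro a ha b hb c hc hab hbc
    rw [Finset.mem_filter] at ha hb hc
    by_contra hcon
    have hne := de_ne hab hbc
    have hcx : c ≤ x := by
      by_contra h1
      exact hcons c hc.1 (by omega) (by omega)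
    have hbx : b < x := by omega
    have h1 : de b c ≤ de b x := by
      rcases eq_or_lt_of_le hcx with e | e
      · rw [e]
      · have := de_max hbc e
        omega
    have := hm b hb.1 x hx hbx
    have := de_ne hbx hlt
    exact h a ha.1 b hb.1 x hx y hy hab hbx hlt ⟨by omega, by omega⟩
  · rw [Finset.card_filter_add_card_filter_not]

/-- the first four elements of `t` are `a<b<c<d` and form a local maximum -/
def FirstMax (t : Finset ℕ) : Prop :=
  ∃ a ∈ t, ∃ b ∈ t, ∃ c ∈ t, ∃ d ∈ t, a < b ∧ b < c ∧ c < d ∧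
    (∀ x ∈ t, x = a ∨ x = b ∨ x = c ∨ d ≤ x) ∧ de a b < de b c ∧ de c d < de b c

theorem step {k l N : ℕ} (hk : 3 ≤ k) (h : Good k l N) : Good (k + 1) (2 * l + k) (2 ^ N) := by
  classical
  obtain ⟨φ, hφ⟩ := h
  refine ⟨fun t => if Inc t ∨ Dec t then φ (D t) else if FirstMax t then 0 else 1, ?_⟩
  intro S hS i hi
  by_contra hcard
  obtain ⟨L, hL, hLc, hLS⟩ := top_part S (k - 3) (by omega)
  have hS'c : (S \ L).card = S.card - (k - 3) := by
    rw [Finset.card_sdiff_of_subset hL, hLc]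
  -- a quadruple extends to a `(k+1)`-set
  have ext4 : ∀ a ∈ S \ L, ∀ b ∈ S \ L, ∀ c ∈ S \ L, ∀ d ∈ S \ L, a < b → b < c → c < d →
      ∃ t ⊆ S, t.card = k + 1 ∧ a ∈ t ∧ b ∈ t ∧ c ∈ t ∧ d ∈ t ∧
        ∀ x ∈ t, x = a ∨ x = b ∨ x = c ∨ d ≤ x := by
    intro a ha b hb c hc d hd hab hbc hcd
    have hnL : ∀ z ∈ S \ L, z ∉ L := fun z hz => (Finset.mem_sdiff.1 hz).2
    refine ⟨insert a (insert b (insert c (insert d L))), ?_, ?_, by simp, by simp, by simp,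
      by simp, ?_⟩
    · intro x hx
      simp only [Finset.mem_insert] at hx
      rcases hx with rfl | rfl | rfl | rfl | hx
      · exact (Finset.mem_sdiff.1 ha).1
      · exact (Finset.mem_sdiff.1 hb).1
      · exact (Finset.mem_sdiff.1 hc).1
      · exact (Finset.mem_sdiff.1 hd).1
      · exact hL hx
    · have := hnL a ha
      have := hnL b hb
      have := hnL c hc
      have := hnL d hd
      rw [Finset.card_insert_of_notMem, Finset.card_insert_of_notMem,
        Finset.card_insert_of_notMem, Finset.card_insert_of_notMem, hLc]
      · omega
      · assumption
      · simp only [Finset.mem_insert, not_or]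
        exact ⟨by omega, by assumption⟩
      · simp only [Finset.mem_insert, not_or]
        exact ⟨by omega, by omega, by assumption⟩
      · simp only [Finset.mem_insert, not_or]
        exact ⟨by omega, by omega, by omega, by assumption⟩
    · intro x hx
      simp only [Finset.mem_insert] at hx
      rcases hx with h | h | h | h | hx
      · exact Or.inl h
      · exact Or.inr (Or.inl h)
      · exact Or.inr (Or.inr (Or.inl h))
      · exact Or.inr (Or.inr (Or.inr h.ge))
      · exact Or.inr (Or.inr (Or.inr (hLS d hd x hx).le))
  -- big monotone subsets
  have main : ∃ A ⊆ S \ L, ∃ B ⊆ S \ L, Inc A ∧ Dec B ∧ (S \ L).card ≤ A.card + B.card := by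
    by_cases hi0 : i = 0
    · apply no_min
      intro a ha b hb c hc d hd hab hbc hcd hloc
      obtain ⟨t, htS, htc, hat, hbt, hct, hdt, hfirst⟩ := ext4 a ha b hb c hc d hd hab hbc hcd
      have := hi t htS htc
      have h1 : ¬ (Inc t ∨ Dec t) := by
        rintro (h1 | h1)
        · have := h1 a hat b hbt c hct hab hbc
          omega
        · have := h1 b hbt c hct d hdt hbc hcd
          omega
      have h2 : ¬ FirstMax t := by
        rintro ⟨a', ha', b', hb', c', hc', d', hd', hab', hbc', hcd', hf', hm1, hm2⟩
        have e1 := hfirst a' ha'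
        have e2 := hfirst b' hb'
        have e3 := hfirst c' hc'
        have e5 := hf' a hat
        have e6 := hf' b hbt
        have e7 := hf' c hct
        have ea : a' = a := by omega
        have eb : b' = b := by omega
        have ec : c' = c := by omega
        subst ea eb ec
        omega
      rw [hi0] at this
      simp [h1, h2] at this
    · apply no_max
      intro a ha b hb c hc d hd hab hbc hcd hloc
      obtain ⟨t, htS, htc, hat, hbt, hct, hdt, hfirst⟩ := ext4 a ha b hb c hc d hd hab hbc hcd
      have := hi t htS htc
      have h1 : ¬ (Inc t ∨ Dec t) := by
        rintro (h1 | h1)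
        · have := h1 b hbt c hct d hdt hbc hcd
          omega
        · have := h1 a hat b hbt c hct hab hbc
          omega
      have h2 : FirstMax t :=
        ⟨a, hat, b, hbt, c, hct, d, hdt, hab, hbc, hcd, hfirst, hloc⟩
      simp [h1, h2] at this
      exact hi0 this.symm
  have small : ∀ V ⊆ S, (Inc V ∨ Dec V) → V.card ≤ l := by
    intro V hV hmon
    rcases V.eq_empty_or_nonempty with rfl | h0
    · simp
    have hc : (D V).card + 1 = V.card ∧
        ∀ T ⊆ D V, ∃ t ⊆ V, t.card = T.card + 1 ∧ D t = T := by
      rcases hmon with h | h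
      · exact comb_inc h0 h
      · exact comb_dec h0 h
    have := hφ (D V) (D_sub (hV.trans hS)) i (by
      intro T hT hTc
      obtain ⟨t, htV, htc, rfl⟩ := hc.2 T hT
      have := hi t (htV.trans hV) (by omega)
      have h1 : Inc t ∨ Dec t := hmon.imp (fun h => h.mono htV) (fun h => h.mono htV)
      simpa [h1] using this)
    omega
  obtain ⟨A, hA, B, hB, hIA, hDB, hle⟩ := main
  have := small A (hA.trans Finset.sdiff_subset) (Or.inl hIA)
  have := small B (hB.trans Finset.sdiff_subset) (Or.inr hDB)
  omega

/-- `g` is a graph on `range N` with no clique of size `s` and no independent set of size `n` -/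
def RGraph (g : ℕ → ℕ → Prop) (N s n : ℕ) : Prop :=
  (∀ x y, g x y → g y x) ∧
  (∀ K ⊆ Finset.range N, (∀ x ∈ K, ∀ y ∈ K, x ≠ y → g x y) → K.card < s) ∧
  (∀ K ⊆ Finset.range N, (∀ x ∈ K, ∀ y ∈ K, x ≠ y → ¬ g x y) → K.card < n)

theorem chain_lemma {g : ℕ → ℕ → Prop} (hg : ∀ x y, g x y → g y x) :
    ∀ (m : ℕ) (S : Finset ℕ), S.card = m → S.Nonempty →
      (∀ a ∈ S, ∀ b ∈ S, ∀ c ∈ S, a < b → b < c → g (de a b) (de b c)) →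
      ∃ K ⊆ D S, (∀ x ∈ K, ∀ y ∈ K, x ≠ y → g x y) ∧ S.card ≤ 2 ^ K.card := by
  classical
  intro m
  induction m using Nat.strong_induction_on with
  | _ m ih =>
  intro S hSm h0 hS
  by_cases h1 : S.card ≤ 1
  · exact ⟨∅, by simp, by simp, by simpa using h1⟩
  have hp := Finset.min'_mem S h0
  have hq := Finset.max'_mem S h0
  have hpm : ∀ a ∈ S, S.min' h0 ≤ a := fun a ha => Finset.min'_le _ _ ha
  have hqm : ∀ a ∈ S, a ≤ S.max' h0 := fun a ha => Finset.le_max' _ _ ha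
  have hpq : S.min' h0 < S.max' h0 := Finset.min'_lt_max'_of_card _ (by omega)
  set p := S.min' h0
  set q := S.max' h0
  have aux : ∀ A ⊆ S, A.Nonempty → A.card < S.card → S.card ≤ 2 * A.card →
      (∀ x ∈ D A, x < de p q ∧ g x (de p q)) →
      ∃ K ⊆ D S, (∀ x ∈ K, ∀ y ∈ K, x ≠ y → g x y) ∧ S.card ≤ 2 ^ K.card := by
    intro A hA hA0 hAc hA2 hAD
    obtain ⟨K, hK, hKg, hKc⟩ := ih A.card (by omega) A rfl hA0
      (fun a ha b hb c hc => hS a (hA ha) b (hA hb) c (hA hc))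
    refine ⟨insert (de p q) K, ?_, ?_, ?_⟩
    · intro x hx
      rcases Finset.mem_insert.1 hx with rfl | hx
      · exact mem_D.2 ⟨p, hp, q, hq, hpq, rfl⟩
      · exact D_mono hA (hK hx)
    · intro x hx y hy hxy
      rcases Finset.mem_insert.1 hx with hx | hx <;> rcases Finset.mem_insert.1 hy with hy | hy
      · omega
      · rw [hx]; exact hg _ _ (hAD y (hK hy)).2
      · rw [hy]; exact (hAD x (hK hx)).2
      · exact hKg x hx y hy hxy
    · rw [Finset.card_insert_of_notMem, pow_succ]
      · omega
      · intro h
        exact absurd (hAD _ (hK h)).1 (lt_irrefl _)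
  have hsum := Finset.card_filter_add_card_filter_not (s := S)
    (fun a => a = p ∨ de p a < de p q)
  have hpA : p ∈ S.filter (fun a => a = p ∨ de p a < de p q) := by simp [hp]
  have hqB : q ∈ S.filter (fun a => ¬ (a = p ∨ de p a < de p q)) := by
    simp [hq]; omega
  have hA0 := Finset.card_pos.2 ⟨p, hpA⟩
  have hB0 := Finset.card_pos.2 ⟨q, hqB⟩
  rcases le_total (S.filter (fun a => a = p ∨ de p a < de p q)).card
    (S.filter (fun a => ¬ (a = p ∨ de p a < de p q))).card with hle | hle
  · refine aux _ (Finset.filter_subset _ _) ⟨q, hqB⟩ (by omega) (by omega) ?_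
    intro x hx
    obtain ⟨a, ha, b, hb, hab, rfl⟩ := mem_D.1 hx
    rw [Finset.mem_filter, not_or, not_lt] at ha hb
    have hpa : p < a := by have := hpm a ha.1; omega
    have h1 := de_max hpa hab
    have h2 := de_ne hpa hab
    have h3 : ∀ z ∈ S, p < z → de p z ≤ de p q := by
      intro z hz hpz
      rcases eq_or_lt_of_le (hqm z hz) with e | e
      · rw [e]
      · have := de_max hpz e
        omega
    have h4 := h3 a ha.1 hpa
    have h5 := h3 b hb.1 (hpa.trans hab)
    have h6 : de p a = de p q := by omega
    refine ⟨by omega, ?_⟩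
    rw [← h6]
    exact hg _ _ (hS p hp a ha.1 b hb.1 hpa hab)
  · refine aux _ (Finset.filter_subset _ _) ⟨p, hpA⟩ (by omega) (by omega) ?_
    intro x hx
    obtain ⟨a, ha, b, hb, hab, rfl⟩ := mem_D.1 hx
    rw [Finset.mem_filter] at ha hb
    have hpb : p < b := by have := hpm a ha.1; omega
    have h2 : de p b < de p q := by rcases hb.2 with h | h <;> omega
    have hbq : b < q := by
      rcases eq_or_lt_of_le (hqm b hb.1) with e | e
      · rw [e] at h2; omega
      · exact e
    have h3 := de_max hpb hbq
    have h4 : de b q = de p q := by omega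
    have h5 : de a b ≤ de p b := by
      rcases eq_or_lt_of_le (hpm a ha.1) with e | e
      · rw [e]
      · have := de_max e hab
        omega
    refine ⟨by omega, ?_⟩
    rw [← h4]
    exact hS a ha.1 b hb.1 q hq hab hbq

theorem D_triple {a b c x : ℕ} (hab : a < b) (hbc : b < c)
    (hx : x ∈ D ({a, b, c} : Finset ℕ)) : x = de a b ∨ x = de b c := by
  obtain ⟨u, hu, v, hv, huv, rfl⟩ := mem_D.1 hx
  have := de_max hab hbc
  simp only [Finset.mem_insert, Finset.mem_singleton] at hu hv
  rcases hu with rfl | rfl | rfl <;> rcases hv with rfl | rfl | rfl <;> omega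

theorem Inc_triple {a b c : ℕ} (hab : a < b) (hbc : b < c) (h : de a b < de b c) :
    Inc ({a, b, c} : Finset ℕ) := by
  intro x hx y hy z hz hxy hyz
  simp only [Finset.mem_insert, Finset.mem_singleton] at hx hy hz
  have e1 : x = a := by omega
  have e2 : y = b := by omega
  have e3 : z = c := by omega
  subst e1 e2 e3
  exact h

theorem card_triple {a b c : ℕ} (hab : a < b) (hbc : b < c) :
    ({a, b, c} : Finset ℕ).card = 3 := by
  rw [Finset.card_eq_three]
  exact ⟨a, b, c, by omega, by omega, by omega, rfl⟩

theorem base {g : ℕ → ℕ → Prop} {N s n l : ℕ} (hG : RGraph g N s n) (hn : n < l)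
    (hs : 2 ^ s ≤ l) : Good 3 l (2 ^ N) := by
  classical
  obtain ⟨hsym, hcl, hind⟩ := hG
  refine ⟨fun t => if ∃ x ∈ D t, ∃ y ∈ D t, x ≠ y ∧ g x y then 2 else if Inc t then 0 else 1, ?_⟩
  intro S hS i hi
  rcases S.eq_empty_or_nonempty with rfl | h0
  · simp; omega
  have tri : ∀ a ∈ S, ∀ b ∈ S, ∀ c ∈ S, ({a, b, c} : Finset ℕ) ⊆ S := by
    intro a ha b hb c hc x hx
    simp only [Finset.mem_insert, Finset.mem_singleton] at hx
    rcases hx with rfl | rfl | rfl <;> assumption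
  by_cases hi2 : i = 2
  · obtain ⟨K, hK, hKg, hKc⟩ := chain_lemma hsym S.card S rfl h0 (by
      intro a ha b hb c hc hab hbc
      have := hi _ (tri a ha b hb c hc) (card_triple hab hbc)
      dsimp only at this
      rw [hi2] at this
      by_cases hex : ∃ x ∈ D ({a, b, c} : Finset ℕ), ∃ y ∈ D ({a, b, c} : Finset ℕ), x ≠ y ∧ g x y
      · obtain ⟨x, hx, y, hy, hxy, hgxy⟩ := hex
        rcases D_triple hab hbc hx with e1 | e1 <;> rcases D_triple hab hbc hy with e2 | e2
        · omega
        · rw [← e1, ← e2]; exact hgxy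
        · rw [← e1, ← e2]; exact hsym _ _ hgxy
        · omega
      · rw [if_neg hex] at this
        split_ifs at this <;> simp at this)
    have h1 := hcl K (hK.trans (D_sub hS)) hKg
    have h2 : 2 ^ K.card < 2 ^ s := Nat.pow_lt_pow_right (by norm_num) h1
    omega
  · have hnb : ∀ t ⊆ S, t.card = 3 → ¬ ∃ x ∈ D t, ∃ y ∈ D t, x ≠ y ∧ g x y := by
      intro t ht htc hex
      have := hi t ht htc
      simp only [if_pos hex] at this
      exact hi2 this.symm
    have hmon : Inc S ∨ Dec S := by
      by_cases hi0 : i = 0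
      · left
        intro a ha b hb c hc hab hbc
        have hs := tri a ha b hb c hc
        have := hi _ hs (card_triple hab hbc)
        dsimp only at this
        rw [if_neg (hnb _ hs (card_triple hab hbc)), hi0] at this
        by_cases hI : Inc ({a, b, c} : Finset ℕ)
        · exact hI a (by simp) b (by simp) c (by simp) hab hbc
        · simp [hI] at this
      · right
        intro a ha b hb c hc hab hbc
        have hs := tri a ha b hb c hc
        have := hi _ hs (card_triple hab hbc)
        dsimp only at this
        rw [if_neg (hnb _ hs (card_triple hab hbc))] at this
        by_cases hI : Inc ({a, b, c} : Finset ℕ)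
        · simp only [hI, if_true] at this
          exact absurd this.symm hi0
        · have h1 := de_ne hab hbc
          by_contra h2
          exact hI (Inc_triple hab hbc (by omega))
    have hc : (D S).card + 1 = S.card ∧
        ∀ T ⊆ D S, ∃ t ⊆ S, t.card = T.card + 1 ∧ D t = T := by
      rcases hmon with h | h
      · exact comb_inc h0 h
      · exact comb_dec h0 h
    have := hind (D S) (D_sub hS) (by
      intro x hx y hy hxy hgxy
      obtain ⟨t, htS, htc, hDt⟩ := hc.2 {x, y} (by
        intro z hz
        simp only [Finset.mem_insert, Finset.mem_singleton] at hz
        rcases hz with rfl | rfl <;> assumption)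
      rw [Finset.card_pair hxy] at htc
      exact hnb t htS htc ⟨x, by simp [hDt], y, by simp [hDt], hxy, hgxy⟩)
    omega

theorem count_fun {E : Type*} [Fintype E] [DecidableEq E] {m : ℕ} (P : Finset E)
    (A : Finset (Fin m)) :
    (Finset.univ.filter (fun f : E → Fin m => ∀ e ∈ P, f e ∈ A)).card * m ^ P.card
      = A.card ^ P.card * m ^ Fintype.card E := by
  have h1 : Finset.univ.filter (fun f : E → Fin m => ∀ e ∈ P, f e ∈ A)
      = Fintype.piFinset (fun e => if e ∈ P then A else Finset.univ) := by
    ext f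
    simp only [Finset.mem_filter, Finset.mem_univ, true_and, Fintype.mem_piFinset]
    refine forall_congr' fun e => ?_
    by_cases he : e ∈ P <;> simp [he]
  rw [h1, Fintype.card_piFinset]
  have h2 : ∀ e : E, (if e ∈ P then A else Finset.univ).card = if e ∈ P then A.card else m := by
    intro e
    by_cases he : e ∈ P <;> simp [he]
  simp only [h2]
  rw [Finset.prod_ite, Finset.prod_const, Finset.prod_const, mul_assoc, ← pow_add]
  have h3 : Finset.univ.filter (fun e => e ∈ P) = P := by ext; simp
  have h4 := Finset.card_filter_add_card_filter_not (s := (Finset.univ : Finset E))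
    (fun e => e ∈ P)
  rw [h3] at h4 ⊢
  congr 2
  rw [← Finset.card_univ]
  omega

/-- one half of the union bound -/
theorem union_bound {N m s : ℕ} (hm : 0 < m) (A : Finset (Fin m)) :
    (Finset.univ.filter (fun f : Sym2 (Fin N) → Fin m =>
      ∃ K ∈ Finset.powersetCard s (Finset.univ : Finset (Fin N)),
        ∀ e ∈ K.offDiag.image (fun p : Fin N × Fin N => s(p.1, p.2)), f e ∈ A)).card
      * m ^ (s.choose 2)
    ≤ N ^ s * A.card ^ (s.choose 2) * m ^ Fintype.card (Sym2 (Fin N)) := by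
  classical
  have hsub : Finset.univ.filter (fun f : Sym2 (Fin N) → Fin m =>
      ∃ K ∈ Finset.powersetCard s (Finset.univ : Finset (Fin N)),
        ∀ e ∈ K.offDiag.image (fun p : Fin N × Fin N => s(p.1, p.2)), f e ∈ A)
      ⊆ (Finset.powersetCard s (Finset.univ : Finset (Fin N))).biUnion (fun K =>
        Finset.univ.filter (fun f : Sym2 (Fin N) → Fin m =>
          ∀ e ∈ K.offDiag.image (fun p : Fin N × Fin N => s(p.1, p.2)), f e ∈ A)) := by
    intro f hf
    simp only [Finset.mem_filter, Finset.mem_univ, true_and, Finset.mem_biUnion] at hf ⊢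
    exact hf
  calc _ ≤ (∑ K ∈ Finset.powersetCard s (Finset.univ : Finset (Fin N)),
        (Finset.univ.filter (fun f : Sym2 (Fin N) → Fin m =>
          ∀ e ∈ K.offDiag.image (fun p : Fin N × Fin N => s(p.1, p.2)), f e ∈ A)).card)
          * m ^ (s.choose 2) :=
        Nat.mul_le_mul_right _ ((Finset.card_le_card hsub).trans Finset.card_biUnion_le)
    _ = ∑ K ∈ Finset.powersetCard s (Finset.univ : Finset (Fin N)),
          A.card ^ (s.choose 2) * m ^ Fintype.card (Sym2 (Fin N)) := by
        rw [Finset.sum_mul]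
        refine Finset.sum_congr rfl fun K hK => ?_
        have hKc := (Finset.mem_powersetCard.1 hK).2
        have hc : (K.offDiag.image (fun p : Fin N × Fin N => s(p.1, p.2))).card = s.choose 2 := by
          rw [← hKc]
          exact Sym2.card_image_offDiag K
        have := count_fun (K.offDiag.image (fun p : Fin N × Fin N => s(p.1, p.2))) A
        rw [hc] at this
        exact this
    _ = N.choose s * (A.card ^ (s.choose 2) * m ^ Fintype.card (Sym2 (Fin N))) := by
        rw [Finset.sum_const, Finset.card_powersetCard, Finset.card_univ, Fintype.card_fin,
          smul_eq_mul]
    _ ≤ N ^ s * (A.card ^ (s.choose 2) * m ^ Fintype.card (Sym2 (Fin N))) :=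
        Nat.mul_le_mul_right _ (Nat.choose_le_pow _ _)
    _ = _ := by ring

theorem graph_exists {N m s n : ℕ} (hm : 0 < m) (h1 : 2 * N ^ s ≤ m ^ (s.choose 2))
    (h2 : 2 * (N ^ n * (m - 1) ^ (n.choose 2)) < m ^ (n.choose 2)) :
    ∃ g, RGraph g N s n := by
  classical
  haveI : NeZero m := ⟨hm.ne'⟩
  have u1 := union_bound (N := N) (s := s) hm {(0 : Fin m)}
  have u2 := union_bound (N := N) (s := n) hm ({(0 : Fin m)}ᶜ)
  rw [Finset.card_singleton, one_pow, mul_one] at u1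
  rw [Finset.card_compl, Finset.card_singleton, Fintype.card_fin] at u2
  set X := Finset.univ.filter (fun f : Sym2 (Fin N) → Fin m =>
      ∃ K ∈ Finset.powersetCard s (Finset.univ : Finset (Fin N)),
        ∀ e ∈ K.offDiag.image (fun p : Fin N × Fin N => s(p.1, p.2)), f e ∈ ({(0 : Fin m)} : Finset (Fin m)))
    with hX
  set Y := Finset.univ.filter (fun f : Sym2 (Fin N) → Fin m =>
      ∃ K ∈ Finset.powersetCard n (Finset.univ : Finset (Fin N)),
        ∀ e ∈ K.offDiag.image (fun p : Fin N × Fin N => s(p.1, p.2)), f e ∈ ({(0 : Fin m)}ᶜ : Finset (Fin m)))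
    with hY
  set E := Fintype.card (Sym2 (Fin N)) with hE
  have hE0 : 0 < m ^ E := by positivity
  have v1 : 2 * X.card ≤ m ^ E := by
    have hp : 0 < m ^ (s.choose 2) := by positivity
    refine Nat.le_of_mul_le_mul_right (c := m ^ (s.choose 2)) ?_ hp
    calc 2 * X.card * m ^ (s.choose 2) = 2 * (X.card * m ^ (s.choose 2)) := by ring
      _ ≤ 2 * (N ^ s * m ^ E) := by gcongr
      _ = (2 * N ^ s) * m ^ E := by ring
      _ ≤ m ^ (s.choose 2) * m ^ E := by gcongr
      _ = _ := by ring
  have v2 : 2 * Y.card < m ^ E := by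
    refine Nat.lt_of_mul_lt_mul_right (a := m ^ (n.choose 2)) ?_
    calc 2 * Y.card * m ^ (n.choose 2) = 2 * (Y.card * m ^ (n.choose 2)) := by ring
      _ ≤ 2 * (N ^ n * (m - 1) ^ (n.choose 2) * m ^ E) := by gcongr
      _ = (2 * (N ^ n * (m - 1) ^ (n.choose 2))) * m ^ E := by ring
      _ < m ^ (n.choose 2) * m ^ E := by gcongr
      _ = _ := by ring
  obtain ⟨f, hf⟩ : ∃ f, f ∉ X ∪ Y := by
    by_contra hcon
    push Not at hcon
    have h3 : X ∪ Y = Finset.univ := Finset.eq_univ_iff_forall.2 hcon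
    have h4 := Finset.card_union_le X Y
    rw [h3, Finset.card_univ, Fintype.card_fun, Fintype.card_fin, ← hE] at h4
    omega
  rw [Finset.mem_union, not_or] at hf
  obtain ⟨hfX, hfY⟩ := hf
  simp only [hX, hY, Finset.mem_filter, Finset.mem_univ, true_and, Finset.mem_powersetCard,
    Finset.subset_univ, not_exists, not_and, Finset.mem_image, Finset.mem_offDiag,
    Finset.mem_compl, Finset.mem_singleton] at hfX hfY
  refine ⟨fun x y => ∃ (hx : x < N) (hy : y < N), f s(⟨x, hx⟩, ⟨y, hy⟩) = 0, ?_, ?_, ?_⟩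
  · rintro x y ⟨hx, hy, h⟩
    exact ⟨hy, hx, by rw [Sym2.eq_swap]; exact h⟩
  · intro K hK hKg
    by_contra hcon
    obtain ⟨K', hK', hK'c⟩ := Finset.exists_subset_card_eq (not_lt.1 hcon)
    have hlt : ∀ z ∈ K', z < N := fun z hz => Finset.mem_range.1 (hK (hK' hz))
    refine hfX (K'.attachFin hlt) (by rw [Finset.card_attachFin, hK'c]) ?_
    rintro e ⟨⟨x, y⟩, ⟨hx, hy, hxy⟩, rfl⟩
    rw [Finset.mem_attachFin] at hx hy
    obtain ⟨_, _, h⟩ := hKg x (hK' hx) y (hK' hy) (fun h => hxy (Fin.ext h))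
    exact h
  · intro K hK hKg
    by_contra hcon
    obtain ⟨K', hK', hK'c⟩ := Finset.exists_subset_card_eq (not_lt.1 hcon)
    have hlt : ∀ z ∈ K', z < N := fun z hz => Finset.mem_range.1 (hK (hK' hz))
    refine hfY (K'.attachFin hlt) (by rw [Finset.card_attachFin, hK'c]) ?_
    rintro e ⟨⟨x, y⟩, ⟨hx, hy, hxy⟩, rfl⟩ h
    rw [Finset.mem_attachFin] at hx hy
    exact hKg x (hK' hx) y (hK' hy) (fun h => hxy (Fin.ext h)) ⟨x.2, y.2, h⟩

theorem bern (m : ℕ) (hm : 0 < m) : 2 * (m - 1) ^ m ≤ m ^ m := by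
  obtain ⟨d, rfl⟩ : ∃ d, m = d + 1 := ⟨m - 1, by omega⟩
  simp only [Nat.add_sub_cancel]
  have key : d ^ (d + 1) + (d + 1) * d ^ d ≤ (d + 1) ^ (d + 1) := by
    rw [add_pow]
    simp only [one_pow, mul_one]
    rw [Finset.sum_range_succ, Finset.sum_range_succ]
    simp
    have := Nat.zero_le (∑ x ∈ Finset.range d, d ^ x * (d + 1).choose x)
    have e : d ^ d * (d + 1) = (d + 1) * d ^ d := mul_comm _ _
    omega
  rw [pow_succ d d] at *
  nlinarith [Nat.zero_le (d ^ d)]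

theorem sq_bound (t : ℕ) (ht : 7 ≤ t) : t * (t - 1) + 2 ≤ 2 ^ (t - 1) := by
  induction t, ht using Nat.le_induction with
  | base => norm_num
  | succ t ht ih =>
    obtain ⟨d, rfl⟩ : ∃ d, t = d + 1 := ⟨t - 1, by omega⟩
    simp only [Nat.add_sub_cancel] at ih ⊢
    rw [pow_succ]
    nlinarith

theorem params (t : ℕ) (ht : 7 ≤ t) : ∃ g, RGraph g (2 ^ (t * (t - 1))) (2 * t) (4 ^ t) := by
  have hsq := sq_bound t ht
  refine graph_exists (m := 2 ^ t) (by positivity) ?_ ?_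
  · have : (2 * t).choose 2 = t * (2 * t - 1) := by
      rw [Nat.choose_two_right, mul_assoc, Nat.mul_div_cancel_left _ (by norm_num)]
    rw [this, ← pow_mul, ← pow_mul, ← pow_succ']
    apply Nat.pow_le_pow_right (by norm_num)
    obtain ⟨d, rfl⟩ : ∃ d, t = d + 1 := ⟨t - 1, by omega⟩
    have : 2 * (d + 1) - 1 = 2 * d + 1 := by omega
    rw [this]
    simp only [Nat.add_sub_cancel]
    nlinarith
  · have hq : (4 ^ t).choose 2 = 2 ^ t * (2 ^ (t - 1) * (4 ^ t - 1)) := by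
      rw [Nat.choose_two_right]
      apply Nat.div_eq_of_eq_mul_right (by norm_num)
      obtain ⟨d, rfl⟩ : ∃ d, t = d + 1 := ⟨t - 1, by omega⟩
      have : (4 : ℕ) ^ (d + 1) = 2 * 2 ^ (d + 1) * 2 ^ d := by
        rw [show (4 : ℕ) = 2 ^ 2 by norm_num, ← pow_mul]
        ring
      simp only [Nat.add_sub_cancel]
      calc 4 ^ (d + 1) * (4 ^ (d + 1) - 1) = (2 * 2 ^ (d + 1) * 2 ^ d) * (4 ^ (d + 1) - 1) := by
            rw [← this]
        _ = _ := by ring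
    rw [hq]
    set r := 2 ^ (t - 1) * (4 ^ t - 1) with hr
    set m := 2 ^ t with hm
    have hm0 : 0 < m := by positivity
    have hb : 2 ^ r * (m - 1) ^ (m * r) ≤ m ^ (m * r) := by
      rw [pow_mul (m - 1), pow_mul m m, ← mul_pow]
      exact Nat.pow_le_pow_left (bern m hm0) r
    have hm1 : 0 < (m - 1) ^ (m * r) := by
      have : 2 ^ 1 ≤ m := Nat.pow_le_pow_right (by norm_num) (by omega)
      have : 0 < m - 1 := by omega
      positivity
    have hexp : 1 + t * (t - 1) * 4 ^ t < r := by
      have h4 : 2 ^ (t - 1) < 4 ^ t := by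
        calc 2 ^ (t - 1) < 2 ^ t := Nat.pow_lt_pow_right (by norm_num) (by omega)
          _ ≤ 4 ^ t := Nat.pow_le_pow_left (by norm_num) t
      rw [hr, Nat.mul_sub (2 ^ (t - 1)) (4 ^ t) 1, mul_one (2 ^ (t - 1))]
      have h5 : (t * (t - 1) + 2) * 4 ^ t ≤ 2 ^ (t - 1) * 4 ^ t := Nat.mul_le_mul_right _ hsq
      have h6 : 1 ≤ 2 ^ (t - 1) := Nat.one_le_two_pow
      have h7 : (t * (t - 1) + 2) * 4 ^ t = t * (t - 1) * 4 ^ t + 2 * 4 ^ t := by ring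
      rw [h7] at h5
      generalize t * (t - 1) * 4 ^ t = u at *
      generalize 2 ^ (t - 1) * 4 ^ t = v at *
      generalize 2 ^ (t - 1) = w at *
      generalize 4 ^ t = z at *
      omega
    calc 2 * ((2 ^ (t * (t - 1))) ^ 4 ^ t * (m - 1) ^ (m * r))
        = 2 ^ (1 + t * (t - 1) * 4 ^ t) * (m - 1) ^ (m * r) := by
          rw [← pow_mul, pow_add]; ring
      _ < 2 ^ r * (m - 1) ^ (m * r) := by
          apply Nat.mul_lt_mul_of_pos_right _ hm1
          exact Nat.pow_lt_pow_right (by norm_num) hexp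
      _ ≤ _ := hb

def ntw : ℕ → ℕ → ℕ
  | 0, x => x
  | (j + 1), x => 2 ^ (ntw j x)

theorem good_all (j t : ℕ) (ht : 7 ≤ t) (htj : j + 3 ≤ t) :
    Good (j + 3) (3 ^ j * (2 * 4 ^ t)) (ntw (j + 1) (2 ^ (t * (t - 1)))) := by
  have h4 : t < 4 ^ t := Nat.lt_pow_self (by norm_num)
  induction j with
  | zero =>
    obtain ⟨g, hg⟩ := params t ht
    have : 2 ^ (2 * t) = 4 ^ t := by rw [pow_mul]; norm_num
    simpa [ntw] using base hg (l := 2 * 4 ^ t) (by omega) (by omega)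
  | succ j ih =>
    have h := step (by omega) (ih (by omega))
    refine h.mono ?_
    have : 1 ≤ 3 ^ j := Nat.one_le_pow _ _ (by norm_num)
    have : 2 * 4 ^ t ≤ 3 ^ j * (2 * 4 ^ t) := Nat.le_mul_of_pos_left _ this
    have e : 3 ^ (j + 1) * (2 * 4 ^ t) = 3 * (3 ^ j * (2 * 4 ^ t)) := by ring
    rw [e]
    omega

theorem twr_mono (j : ℕ) {x y : ℝ} (h : x ≤ y) : twr j x ≤ twr j y := by
  induction j with
  | zero => exact h
  | succ j ih => exact Real.rpow_le_rpow_of_exponent_le (by norm_num) ih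

theorem twr_cast (j x : ℕ) : twr j (x : ℝ) = (ntw j x : ℝ) := by
  induction j with
  | zero => rfl
  | succ j ih =>
    simp only [twr, ntw]
    rw [ih, Real.rpow_natCast]
    push_cast
    rfl

theorem real_bound (j t l : ℕ) (ht : 7 ≤ t) (htj : 2 * j + 3 ≤ t)
    (hl1 : 2 ≤ l) (hl : l ≤ 3 ^ j * (2 * 4 ^ (t + 1))) :
    (l : ℝ) ^ ((1 / 6 : ℝ) * Real.logb 2 (Real.logb 2 l)) ≤ ((2 ^ (t * (t - 1)) : ℕ) : ℝ) := by
  have hl2 : l ≤ 2 ^ (3 * t) := by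
    calc l ≤ 3 ^ j * (2 * 4 ^ (t + 1)) := hl
      _ ≤ 4 ^ j * (2 * 4 ^ (t + 1)) := by gcongr; norm_num
      _ = 2 ^ (2 * j + 2 * t + 3) := by
          rw [show (4 : ℕ) = 2 ^ 2 by norm_num, ← pow_mul, ← pow_mul]; ring
      _ ≤ _ := Nat.pow_le_pow_right (by norm_num) (by omega)
  have hlpos : (0 : ℝ) < l := by exact_mod_cast (by omega : 0 < l)
  have hlog : Real.logb 2 l ≤ 3 * t := by
    rw [Real.logb_le_iff_le_rpow (by norm_num) hlpos]
    have : (l : ℝ) ≤ 2 ^ (3 * t) := by exact_mod_cast hl2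
    rw [← Real.rpow_natCast] at this
    simpa using this
  have hlog1 : 1 ≤ Real.logb 2 l := by
    rw [Real.le_logb_iff_rpow_le (by norm_num) hlpos]
    simpa using (by exact_mod_cast hl1 : (2 : ℝ) ≤ l)
  have h3t : 3 * t ≤ 2 ^ t := by
    have := sq_bound t ht
    have h2 : 2 ^ (t - 1) ≤ 2 ^ t := Nat.pow_le_pow_right (by norm_num) (by omega)
    obtain ⟨d, rfl⟩ : ∃ d, t = d + 1 := ⟨t - 1, by omega⟩
    simp only [Nat.add_sub_cancel] at *
    nlinarith
  have hll : Real.logb 2 (Real.logb 2 l) ≤ t := by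
    rw [Real.logb_le_iff_le_rpow (by norm_num) (by linarith), Real.rpow_natCast]
    refine hlog.trans ?_
    exact_mod_cast h3t
  have e : (l : ℝ) = 2 ^ (Real.logb 2 l) := by
    rw [Real.rpow_logb (by norm_num) (by norm_num) hlpos]
  have e2 : (l : ℝ) ^ ((1 / 6 : ℝ) * Real.logb 2 (Real.logb 2 l))
      = 2 ^ (Real.logb 2 l * ((1 / 6 : ℝ) * Real.logb 2 (Real.logb 2 l))) := by
    rw [Real.rpow_mul (x := 2) (by norm_num), ← e]
  rw [e2]
  push_cast
  rw [← Real.rpow_natCast]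
  apply Real.rpow_le_rpow_of_exponent_le (by norm_num)
  have ht7 : (7 : ℝ) ≤ t := by exact_mod_cast ht
  calc Real.logb 2 l * ((1 / 6 : ℝ) * Real.logb 2 (Real.logb 2 l))
      ≤ Real.logb 2 l * ((1 / 6 : ℝ) * t) := by gcongr
    _ ≤ (3 * t) * ((1 / 6 : ℝ) * t) := by gcongr
    _ ≤ t * (t - 1) := by nlinarith
    _ = _ := by
      rw [Nat.cast_mul, Nat.cast_sub (by omega)]
      simp

end StepUp

open StepUp

theorem higher_uniformity_ramsey_lower_bound (k : ℕ) (hk : 3 ≤ k) :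
    ∃ c : ℝ, 0 < c ∧ ∀ᶠ l : ℕ in atTop, ∀ N : ℕ,
      (N : ℝ) < twr (k - 2) ((l : ℝ) ^ (c * Real.logb 2 (Real.logb 2 l))) →
      ∃ χ : Finset (Fin N) → Fin 3,
        ¬ ∃ (S : Finset (Fin N)) (i : Fin 3), S.card = l ∧
            ∀ t ⊆ S, t.card = k → χ t = i := by
  obtain ⟨j, rfl⟩ : ∃ j, k = j + 3 := ⟨k - 3, by omega⟩
  have hj2 : j + 3 - 2 = j + 1 := by omega
  rw [hj2]
  refine ⟨1 / 6, by norm_num, ?_⟩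
  filter_upwards [eventually_ge_atTop (3 ^ j * 2 * 4 ^ (2 * j + 7))] with l hl
  intro N hN
  have hc0 : 0 < 3 ^ j * 2 := by positivity
  have hdiv : 4 ^ (2 * j + 7) ≤ l / (3 ^ j * 2) := by
    rw [Nat.le_div_iff_mul_le hc0, mul_comm]
    exact hl
  have hd0 : l / (3 ^ j * 2) ≠ 0 := by
    have : 0 < 4 ^ (2 * j + 7) := by positivity
    omega
  set t := Nat.log 4 (l / (3 ^ j * 2)) with ht
  have ht1 : 2 * j + 7 ≤ t := Nat.le_log_of_pow_le (by norm_num) hdiv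
  have ht2 : 4 ^ t ≤ l / (3 ^ j * 2) := Nat.pow_log_le_self 4 hd0
  have ht3 : l / (3 ^ j * 2) < 4 ^ (t + 1) := Nat.lt_pow_succ_log_self (by norm_num) _
  rw [Nat.le_div_iff_mul_le hc0] at ht2
  rw [Nat.div_lt_iff_lt_mul hc0] at ht3
  have hl2 : 2 ≤ l := by
    by_contra h
    have : l / (3 ^ j * 2) = 0 := Nat.div_eq_of_lt (by
      have : 1 ≤ 3 ^ j := Nat.one_le_pow _ _ (by norm_num)
      omega)
    exact hd0 this
  have hb := real_bound j t l (by omega) (by omega) hl2 (by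
    refine ht3.le.trans (le_of_eq ?_)
    ring)
  have hNle : N ≤ ntw (j + 1) (2 ^ (t * (t - 1))) := by
    have := hN.le.trans (twr_mono (j + 1) hb)
    rw [twr_cast] at this
    exact_mod_cast this
  obtain ⟨χ, hχ⟩ := (good_all j t (by omega) (by omega)).mono (l' := l) (by
    refine le_trans (le_of_eq ?_) ht2
    ring)
  refine ⟨fun s => χ (s.map Fin.valEmbedding), ?_⟩
  rintro ⟨S, i, hSc, hS⟩
  have := hχ (S.map Fin.valEmbedding) (by
    intro x hx
    obtain ⟨y, hy, rfl⟩ := Finset.mem_map.1 hx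
    exact Finset.mem_range.2 (y.2.trans_le hNle)) i (by
    intro s hs hsc
    obtain ⟨u, hu, rfl⟩ := Finset.subset_map_iff.1 hs
    rw [Finset.card_map] at hsc
    exact hS u hu hsc)
  rw [Finset.card_map] at this
  omega
end
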